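/- arXiv:2504.01944 — 2 statements merged into one kernel-verified Lean document; each statement's English description precedes it below -/
import Mathlib

section
/- Every graphon game with a measure space of agents satisfying assumptions (A1)–(A6) has a Nash equilibrium, i.e. there exists a Bochner integrable f : T → E with f(t) ∈ S(t) for a.e. t and U(t, f(t), ∫ W(t,s) f(s) dμ(s)) = max_{a ∈ S(t)} U(t, a, ∫ W(t,s) f(s) dμ(s)) for a.e. t ∈ T. -/
open MeasureTheory Set Filter Topology

/-- The dominance relation of Scarf: no point exceeds all the coordinatewise minima of `σ`. -/
def ScarfDominant {X I : Type*} (r : I → X → ℕ) (σ : Finset X) : Prop :=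
  ∀ y, ∃ i, ∀ x ∈ σ, r i y ≤ r i x

theorem ScarfDominant.mono {X I : Type*} {r : I → X → ℕ} {σ τ : Finset X}
    (h : ScarfDominant r σ) (hτ : τ ⊆ σ) :
    ScarfDominant r τ := fun y => (h y).imp fun _ hi x hx => hi x (hτ hx)

/-- The elements whose insertion makes a dominant set of codimension one into a dominant set of
full size are obtained by relaxing one of two coordinates. -/
theorem exists_scarf_pair {X I : Type*} [Fintype I] [DecidableEq X] [DecidableEq I]
    {r : I → X → ℕ} (hr : ∀ i, Function.Injective (r i)) {τ : Finset X}
    (hτ : ScarfDominant r τ) (hcard : τ.card + 1 = Fintype.card I) (hne : τ.Nonempty) :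
    ∃ (m : I → X) (a b : I), (∀ i, m i ∈ τ) ∧ (∀ i, ∀ x ∈ τ, r i (m i) ≤ r i x) ∧
      a ≠ b ∧ m a = m b ∧
      (∀ x, (x ∉ τ ∧ ScarfDominant r (insert x τ)) ↔ ∃ k, (k = a ∨ k = b) ∧
        (∀ i, i ≠ k → r i (m i) < r i x) ∧
        ∀ y, (∀ i, i ≠ k → r i (m i) < r i y) → r k y ≤ r k x) := by
  have hmin := fun i => Finset.exists_min_image τ (r i) hne
  choose m hm hmle using hmin
  have hsurj : ∀ x ∈ τ, ∃ i, m i = x := by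
    intro x hx
    obtain ⟨i, hi⟩ := hτ x
    exact ⟨i, hr i (le_antisymm (hmle i x hx) (hi _ (hm i)))⟩
  have himg : Finset.univ.image m = τ := by
    ext x
    simp only [Finset.mem_image, Finset.mem_univ, true_and]
    exact ⟨fun ⟨i, hi⟩ => hi ▸ hm i, hsurj x⟩
  have hninj : ¬ Function.Injective m := by
    intro h
    have := Finset.card_image_of_injective Finset.univ h
    rw [himg, Finset.card_univ] at this
    omega
  obtain ⟨a, b, hab, hne'⟩ : ∃ a b, m a = m b ∧ a ≠ b := by
    simpa [Function.Injective] using hninj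
  refine ⟨m, a, b, hm, hmle, hne', hab, fun x => ⟨?_, ?_⟩⟩
  · rintro ⟨hx, hdom⟩
    have hmin' := fun i => Finset.exists_min_image (insert x τ) (r i) (Finset.insert_nonempty _ _)
    choose m' hm' hmle' using hmin'
    have hsurj' : ∀ z ∈ insert x τ, ∃ i, m' i = z := by
      intro z hz
      obtain ⟨i, hi⟩ := hdom z
      exact ⟨i, hr i (le_antisymm (hmle' i z hz) (hi _ (hm' i)))⟩
    have himg' : Finset.univ.image m' = insert x τ := by
      ext z
      simp only [Finset.mem_image, Finset.mem_univ, true_and]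
      exact ⟨fun ⟨i, hi⟩ => hi ▸ hm' i, hsurj' z⟩
    have hinj' : Set.InjOn m' (Finset.univ : Finset I) := by
      rw [← Finset.card_image_iff, himg', Finset.card_insert_of_notMem hx, hcard, Finset.card_univ]
    obtain ⟨k, hk⟩ := hsurj' x (Finset.mem_insert_self _ _)
    have hne'' : ∀ i, i ≠ k → m' i ≠ x := fun i hi h =>
      hi (hinj' (by simp) (by simp) (h.trans hk.symm))
    have hmm : ∀ i, i ≠ k → m' i = m i := by
      intro i hi
      have h1 : m' i ∈ τ := (Finset.mem_insert.1 (hm' i)).resolve_left (hne'' i hi)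
      exact hr i (le_antisymm (hmle' i _ (Finset.mem_insert_of_mem (hm i))) (hmle i _ h1))
    have hlt : ∀ i, i ≠ k → r i (m i) < r i x := by
      intro i hi
      refine lt_of_le_of_ne ?_ fun h => hx (hr i h ▸ hm i)
      rw [← hmm i hi]
      exact hmle' i x (Finset.mem_insert_self _ _)
    refine ⟨k, ?_, hlt, ?_⟩
    · by_contra hcon
      push Not at hcon
      have := hmm a hcon.1.symm
      have h2 := hmm b hcon.2.symm
      exact hne' (hinj' (by simp) (by simp) (by rw [this, h2, hab]))
    · intro y hy
      obtain ⟨i, hi⟩ := hdom y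
      by_cases hik : i = k
      · subst hik
        exact hi x (Finset.mem_insert_self _ _)
      · exact absurd (hi _ (Finset.mem_insert_of_mem (hm i))) (not_le.2 (hy i hik))
  · rintro ⟨k, hk, hlt, hmax⟩
    refine ⟨fun hx => ?_, fun y => ?_⟩
    · obtain ⟨j, hj⟩ := hsurj x hx
      have hjk : j = k := by
        by_contra h
        exact absurd (hlt j h) (by rw [hj]; exact lt_irrefl _)
      subst hjk
      rcases hk with rfl | rfl
      · exact absurd (hlt b hne'.symm) (by rw [← hab, hj]; exact lt_irrefl _)
      · exact absurd (hlt a hne') (by rw [hab, hj]; exact lt_irrefl _)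
    · by_cases h : ∃ i, i ≠ k ∧ r i y ≤ r i (m i)
      · obtain ⟨i, hi, hle⟩ := h
        refine ⟨i, fun z hz => ?_⟩
        rcases Finset.mem_insert.1 hz with rfl | hz
        · exact hle.trans (hlt i hi).le
        · exact hle.trans (hmle i z hz)
      · push Not at h
        obtain ⟨i, hi⟩ := hτ y
        have hik : i = k := by
          by_contra hik
          exact absurd (hi _ (hm i)) (not_le.2 (h i hik))
        subst hik
        refine ⟨i, fun z hz => ?_⟩
        rcases Finset.mem_insert.1 hz with rfl | hz
        · exact hmax y h
        · exact hi z hz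

/-- A relaxed coordinate contributes exactly one element, provided some candidate exists. -/
theorem existsUnique_scarf_max {X I : Type*} [Fintype X] {r : I → X → ℕ}
    (hr : ∀ i, Function.Injective (r i)) (m : I → X) (k : I)
    (hne : ∃ y, ∀ i, i ≠ k → r i (m i) < r i y) :
    ∃! x, (∀ i, i ≠ k → r i (m i) < r i x) ∧
        ∀ y, (∀ i, i ≠ k → r i (m i) < r i y) → r k y ≤ r k x := by
  obtain ⟨y, hy⟩ := hne
  classical
  obtain ⟨x, hx, hmax⟩ := Finset.exists_max_image
    (Finset.univ.filter fun y => ∀ i, i ≠ k → r i (m i) < r i y) (r k) ⟨y, by simpa using hy⟩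
  simp only [Finset.mem_filter, Finset.mem_univ, true_and] at hx hmax
  exact ⟨x, ⟨hx, hmax⟩, fun z hz => hr k (le_antisymm (hmax z hz.1) (hz.2 x hx))⟩

theorem card_scarf_doors_even {X I : Type*} [Fintype I] [DecidableEq X] [DecidableEq I]
    {c : X → I} {i₀ : I} {σ : Finset X}
    (hcard : σ.card = Fintype.card I) (hc : σ.image c ≠ Finset.univ) :
    Even (σ.filter fun x => (σ.erase x).image c = Finset.univ.erase i₀).card := by
  rcases Finset.eq_empty_or_nonempty
    (σ.filter fun x => (σ.erase x).image c = Finset.univ.erase i₀) with h | ⟨x₀, hx₀⟩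
  · simp [h]
  simp only [Finset.mem_filter] at hx₀
  obtain ⟨hxσ, hx₀⟩ := hx₀
  have hinj : ∀ x ∈ σ, (σ.erase x).image c = Finset.univ.erase i₀ →
      Set.InjOn c (σ.erase x : Finset X) := by
    intro x hx h
    rw [← Finset.card_image_iff, h, Finset.card_erase_of_mem hx, Finset.card_erase_of_mem (by simp),
      hcard, Finset.card_univ]
  have hcx : c x₀ ≠ i₀ := by
    intro h
    apply hc
    rw [← Finset.insert_erase hxσ, Finset.image_insert, hx₀, h, Finset.insert_erase (by simp)]
  obtain ⟨x₁, hx₁, hcc⟩ : ∃ x₁ ∈ σ.erase x₀, c x₁ = c x₀ := by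
    rw [← Finset.mem_image, hx₀]
    simpa using hcx
  have hne : x₁ ≠ x₀ := Finset.ne_of_mem_erase hx₁
  have hx₁σ := Finset.mem_of_mem_erase hx₁
  have : (σ.filter fun x => (σ.erase x).image c = Finset.univ.erase i₀) = {x₀, x₁} := by
    ext x
    simp only [Finset.mem_filter, Finset.mem_insert, Finset.mem_singleton]
    constructor
    · rintro ⟨hx, h⟩
      by_contra hcon
      push Not at hcon
      exact hne (hinj x hx h (by simp [hx₁σ, hcon.2.symm]) (by simp [hxσ, hcon.1.symm]) hcc)
    · rintro (rfl | rfl)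
      · exact ⟨hxσ, hx₀⟩
      · refine ⟨hx₁σ, ?_⟩
        rw [← hx₀]
        have e1 : σ.erase x = insert x₀ ((σ.erase x).erase x₀) :=
          (Finset.insert_erase (by simp [hxσ, hne.symm])).symm
        have e2 : σ.erase x₀ = insert x ((σ.erase x).erase x₀) := by
          rw [Finset.erase_right_comm]
          exact (Finset.insert_erase hx₁).symm
        rw [e1, e2, Finset.image_insert, Finset.image_insert, hcc]
  rw [this, Finset.card_pair hne.symm]
  exact even_two

open Classical in
/-- **Combinatorial lemma of Scarf**, with slack elements `s i`. -/
theorem exists_scarfDominant_image_eq_univ {X I : Type*} [Fintype X] [Fintype I] [Nontrivial I]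
    {r : I → X → ℕ} (hr : ∀ i, Function.Injective (r i))
    (c : X → I) (s : I → X) (hcs : ∀ i, c (s i) = i) (hmin : ∀ i y, r i (s i) ≤ r i y)
    (hmax : ∀ i j y, i ≠ j → (∀ k, y ≠ s k) → r i y < r i (s j)) (hns : ∃ z, ∀ k, z ≠ s k) :
    ∃ σ : Finset X, ScarfDominant r σ ∧ σ.card = Fintype.card I ∧ σ.image c = Finset.univ := by
  obtain ⟨i₀⟩ : Nonempty I := inferInstance
  have hs : Function.Injective s := fun i j h => by rw [← hcs i, h, hcs]
  by_contra hcon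
  push Not at hcon
  let D : Finset (Finset X) := Finset.univ.filter fun τ => ScarfDominant r τ ∧
    τ.card + 1 = Fintype.card I ∧ τ.image c = Finset.univ.erase i₀
  let R : Finset (Finset X) := Finset.univ.filter fun σ => ScarfDominant r σ ∧
    σ.card = Fintype.card I
  have hcount : ∑ τ ∈ D, (Finset.univ.filter fun x => x ∉ τ ∧ ScarfDominant r (insert x τ)).card =
      ∑ σ ∈ R, (σ.filter fun x => (σ.erase x).image c = Finset.univ.erase i₀).card := by
    rw [← Finset.card_sigma, ← Finset.card_sigma]
    refine Finset.card_nbij' (fun p => ⟨insert p.2 p.1, p.2⟩) (fun p => ⟨p.1.erase p.2, p.2⟩)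
      ?_ ?_ ?_ ?_
    · rintro ⟨τ, x⟩ h
      simp only [D, R, Finset.coe_sigma, Set.mem_sigma_iff, Finset.mem_coe, Finset.mem_filter,
        Finset.mem_univ, true_and] at h ⊢
      obtain ⟨⟨h1, h2, h3⟩, h4, h5⟩ := h
      exact ⟨⟨h5, by rw [Finset.card_insert_of_notMem h4, h2]⟩, Finset.mem_insert_self _ _,
        by rw [Finset.erase_insert h4, h3]⟩
    · rintro ⟨σ, x⟩ h
      simp only [D, R, Finset.coe_sigma, Set.mem_sigma_iff, Finset.mem_coe, Finset.mem_filter,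
        Finset.mem_univ, true_and] at h ⊢
      obtain ⟨⟨h1, h2⟩, h4, h5⟩ := h
      exact ⟨⟨h1.mono (Finset.erase_subset _ _), by rw [Finset.card_erase_add_one h4, h2], h5⟩,
        Finset.notMem_erase _ _, by rwa [Finset.insert_erase h4]⟩
    · rintro ⟨τ, x⟩ h
      simp only [Finset.coe_sigma, Set.mem_sigma_iff, Finset.mem_coe, Finset.mem_filter,
        Finset.mem_univ, true_and] at h
      simp [Finset.erase_insert h.2.1]
    · rintro ⟨σ, x⟩ h
      simp only [Finset.coe_sigma, Set.mem_sigma_iff, Finset.mem_coe, Finset.mem_filter] at h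
      simp [Finset.insert_erase h.2.1]
  have heven : Even (∑ σ ∈ R,
      (σ.filter fun x => (σ.erase x).image c = Finset.univ.erase i₀).card) := by
    refine Finset.even_sum _ fun σ hσ => ?_
    simp only [R, Finset.mem_filter, Finset.mem_univ, true_and] at hσ
    exact card_scarf_doors_even hσ.2 (hcon σ hσ.1 hσ.2)
  rw [← hcount] at heven
  have hcard2 : 2 ≤ Fintype.card I := Fintype.one_lt_card
  let τ₀ : Finset X := (Finset.univ.erase i₀).image s
  have hτ₀card : τ₀.card + 1 = Fintype.card I := by
    rw [Finset.card_image_of_injective _ hs, Finset.card_erase_add_one (by simp), Finset.card_univ]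
  have hτ₀ : τ₀ ∈ D := by
    simp only [D, Finset.mem_filter, Finset.mem_univ, true_and]
    refine ⟨fun y => ?_, hτ₀card, ?_⟩
    · by_cases hy : ∃ j, j ≠ i₀ ∧ y = s j
      · obtain ⟨j, hj, rfl⟩ := hy
        exact ⟨j, fun x _ => hmin j x⟩
      · push Not at hy
        refine ⟨i₀, fun x hx => ?_⟩
        simp only [τ₀, Finset.mem_image, Finset.mem_erase, Finset.mem_univ, and_true] at hx
        obtain ⟨j, hj, rfl⟩ := hx
        by_cases hy' : y = s i₀
        · rw [hy']
          exact hmin _ _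
        · refine (hmax i₀ j y hj.symm fun k => ?_).le
          by_cases hk : k = i₀
          · rwa [hk]
          · exact hy k hk
    · rw [Finset.image_image, (funext hcs : c ∘ s = id), Finset.image_id]
  have hsum : ∀ τ ∈ D, τ ≠ τ₀ →
      (Finset.univ.filter fun x => x ∉ τ ∧ ScarfDominant r (insert x τ)).card = 2 := by
    intro τ hτ hne
    simp only [D, Finset.mem_filter, Finset.mem_univ, true_and] at hτ
    obtain ⟨hdom, hcard, himg⟩ := hτ
    have hneτ : τ.Nonempty := by
      rw [← Finset.card_pos]; omega
    obtain ⟨m, a, b, hm, hmle, hab, -, hiff⟩ := exists_scarf_pair hr hdom hcard hneτ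
    obtain ⟨z, hz, hzs⟩ : ∃ z ∈ τ, ∀ k, z ≠ s k := by
      by_contra hall
      push Not at hall
      apply hne
      apply Finset.eq_of_subset_of_card_le
      · intro z hz
        obtain ⟨k, rfl⟩ := hall z hz
        have := Finset.mem_image_of_mem c hz
        rw [himg, hcs] at this
        exact Finset.mem_image_of_mem s this
      · omega
    have hex : ∀ k, ∃ y, ∀ i, i ≠ k → r i (m i) < r i y := fun k =>
      ⟨s k, fun i hi => (hmle i z hz).trans_lt (hmax i k z hi hzs)⟩
    obtain ⟨xa, hxa, hxau⟩ := existsUnique_scarf_max hr m a (hex a)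
    obtain ⟨xb, hxb, hxbu⟩ := existsUnique_scarf_max hr m b (hex b)
    have hxab : xa ≠ xb := by
      rintro rfl
      obtain ⟨i, hi⟩ := hdom xa
      have := hi _ (hm i)
      by_cases hia : i = a
      · exact absurd this (not_le.2 (hxb.1 i (hia ▸ hab)))
      · exact absurd this (not_le.2 (hxa.1 i hia))
    rw [Finset.card_eq_two]
    refine ⟨xa, xb, hxab, ?_⟩
    ext x
    simp only [Finset.mem_filter, Finset.mem_univ, true_and, Finset.mem_insert,
      Finset.mem_singleton]
    rw [hiff]
    constructor
    · rintro ⟨k, rfl | rfl, h⟩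
      · exact Or.inl (hxau x h)
      · exact Or.inr (hxbu x h)
    · rintro (rfl | rfl)
      · exact ⟨a, Or.inl rfl, hxa⟩
      · exact ⟨b, Or.inr rfl, hxb⟩
  have hone : (Finset.univ.filter fun x => x ∉ τ₀ ∧ ScarfDominant r (insert x τ₀)).card = 1 := by
    have hD := hτ₀
    simp only [D, Finset.mem_filter, Finset.mem_univ, true_and] at hD
    obtain ⟨hdom, hcard, himg⟩ := hD
    have hneτ : τ₀.Nonempty := by
      rw [← Finset.card_pos]; omega
    obtain ⟨m, a, b, hm, hmle, hab, hmab, hiff⟩ := exists_scarf_pair hr hdom hcard hneτ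
    have hms : ∀ j, j ≠ i₀ → m j = s j := fun j hj =>
      hr j (le_antisymm (hmle j _ (Finset.mem_image_of_mem s (by simpa using hj))) (hmin _ _))
    obtain ⟨z, hz⟩ := hns
    obtain ⟨x₀, hx₀, hx₀u⟩ := existsUnique_scarf_max hr m i₀ ⟨z, fun i hi => by
      rw [hms i hi]
      exact lt_of_le_of_ne (hmin _ _) fun h => hz i (hr i h).symm⟩
    have key : ∀ b', b' ≠ i₀ → m i₀ = m b' → ¬ ∃ y, ∀ i, i ≠ b' → r i (m i) < r i y := by
      rintro b' hb' hmb ⟨y, hy⟩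
      have h0 := hy i₀ hb'.symm
      rw [hmb, hms b' hb'] at h0
      by_cases hys : ∃ k, y = s k
      · obtain ⟨k, rfl⟩ := hys
        by_cases hk : k = i₀
        · subst hk
          exact absurd h0 (not_lt.2 (hmin _ _))
        · by_cases hkb : k = b'
          · subst hkb
            exact lt_irrefl _ h0
          · have := hy k hkb
            rw [hms k hk] at this
            exact lt_irrefl _ this
      · push Not at hys
        exact absurd h0 (not_lt.2 (hmax i₀ b' y hb'.symm hys).le)
    rw [Finset.card_eq_one]
    refine ⟨x₀, ?_⟩
    ext x
    simp only [Finset.mem_filter, Finset.mem_univ, true_and, Finset.mem_singleton]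
    rw [hiff]
    have hi₀ : a = i₀ ∨ b = i₀ := by
      by_contra h
      push Not at h
      rw [hms a h.1, hms b h.2] at hmab
      exact hab (hs hmab)
    have hother : ∀ k, (k = a ∨ k = b) → k ≠ i₀ → m i₀ = m k := by
      rintro k (rfl | rfl) hk
      · rw [hmab, hi₀.resolve_left hk]
      · rw [← hmab, hi₀.resolve_right hk]
    constructor
    · rintro ⟨k, hk, h⟩
      by_cases hki : k = i₀
      · subst hki
        exact hx₀u x h
      · exact absurd ⟨x, h.1⟩ (key k hki (hother k hk hki))
    · rintro rfl
      exact ⟨i₀, hi₀.imp Eq.symm Eq.symm, hx₀⟩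
  rw [← Finset.add_sum_erase D _ hτ₀, hone, Finset.sum_congr rfl fun τ hτ =>
    hsum τ (Finset.mem_of_mem_erase hτ) (Finset.ne_of_mem_erase hτ), Finset.sum_const,
    smul_eq_mul] at heven
  rw [Nat.even_iff] at heven
  omega

/-- On the grid of mesh `1 / N` every self-map of the simplex has an approximate fixed point. -/
theorem exists_approx_fixedPoint_stdSimplex {I : Type*} [Fintype I] [Nontrivial I]
    {F : (I → ℝ) → I → ℝ} (hF : MapsTo F (stdSimplex ℝ I) (stdSimplex ℝ I)) {N : ℕ} (hN : 0 < N) :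
    ∃ p ∈ stdSimplex ℝ I, ∀ i, ∃ z ∈ stdSimplex ℝ I,
      dist z p ≤ Fintype.card I / N ∧ z i - Fintype.card I / N ≤ F z i := by
  classical
  have hNR : (0 : ℝ) < N := by exact_mod_cast hN
  let G := {p : I → Fin (N + 1) // ∑ i, (p i : ℕ) = N}
  let pt : G → I → ℝ := fun p i => (p.1 i : ℕ) / N
  have hpt : ∀ p, pt p ∈ stdSimplex ℝ I := fun p => by
    refine ⟨fun i => by positivity, ?_⟩
    simp only [pt]
    rw [← Finset.sum_div, div_eq_one_iff_eq hNR.ne']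
    exact_mod_cast p.2
  have mkG : ∀ y : I → ℕ, ∑ i, y i = N → ∃ p : G, ∀ i, (p.1 i : ℕ) = y i := by
    intro y hy
    have hle : ∀ i, y i < N + 1 := fun i => by
      have := Finset.single_le_sum (f := y) (fun _ _ => Nat.zero_le _) (Finset.mem_univ i)
      omega
    exact ⟨⟨fun i => ⟨y i, hle i⟩, hy⟩, fun i => rfl⟩
  have hcol : ∀ p : G, ∃ i, pt p i ≤ F (pt p) i := by
    intro p
    by_contra hcon
    push Not at hcon
    have := Finset.sum_lt_sum_of_nonempty (Finset.univ_nonempty (α := I)) fun i _ => hcon i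
    rw [(hpt p).2, (hF (hpt p)).2] at this
    exact lt_irrefl _ this
  choose col hcol using hcol
  let M := Fintype.card G
  let idx : G ≃ Fin M := Fintype.equivFin G
  let e : I ≃ Fin (Fintype.card I) := Fintype.equivFin I
  let r : I → G ⊕ I → ℕ := fun i x => Sum.elim (fun p : G => 1 + ((p.1 i : ℕ) * M + (idx p : ℕ)))
    (fun j => if j = i then 0 else 1 + ((N + 1) * M + (e j : ℕ))) x
  have hrlt : ∀ i (p : G), r i (Sum.inl p) < 1 + (N + 1) * M := fun i p => by
    have h1 : (p.1 i : ℕ) ≤ N := Nat.lt_succ_iff.1 (p.1 i).2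
    have h2 := (idx p).2
    have h3 : (p.1 i : ℕ) * M ≤ N * M := Nat.mul_le_mul_right _ h1
    simp only [r, Sum.elim_inl]
    rw [add_mul]
    omega
  have hle : ∀ i (p q : G), r i (Sum.inl p) ≤ r i (Sum.inl q) → (p.1 i : ℕ) ≤ q.1 i := by
    intro i p q h
    simp only [r, Sum.elim_inl] at h
    have h2 := (idx q).2
    by_contra hcon
    have h3 : ((q.1 i : ℕ) + 1) * M ≤ (p.1 i : ℕ) * M := Nat.mul_le_mul_right _ (by omega)
    rw [add_mul] at h3
    omega
  have hr : ∀ i, Function.Injective (r i) := by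
    rintro i (p | j) (q | k) h
    · have h1 := le_antisymm (hle i p q h.le) (hle i q p h.ge)
      simp only [r, Sum.elim_inl, h1] at h
      have : idx p = idx q := Fin.ext (by omega)
      rw [idx.injective this]
    · have := hrlt i p
      rw [h] at this
      simp only [r, Sum.elim_inr, Sum.elim_inl] at h this
      split_ifs at h this <;> omega
    · have := hrlt i q
      rw [← h] at this
      simp only [r, Sum.elim_inr, Sum.elim_inl] at h this
      split_ifs at h this <;> omega
    · simp only [r, Sum.elim_inr] at h
      split_ifs at h with h1 h2 h2
      · rw [h1, h2]
      · omega
      · omega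
      · have : e j = e k := Fin.ext (by omega)
        rw [e.injective this]
  obtain ⟨g₀⟩ : Nonempty G := by
    obtain ⟨i₀⟩ : Nonempty I := inferInstance
    exact ⟨(mkG (Pi.single i₀ N) (by simp)).choose⟩
  obtain ⟨σ, hdom, -, himg⟩ := exists_scarfDominant_image_eq_univ hr (Sum.elim col id) Sum.inr
    (fun i => rfl) (fun i y => by simp [r])
    (by
      rintro i j (p | k) hij hy
      · refine (hrlt i p).trans_le ?_
        simp only [r, Sum.elim_inr, if_neg hij.symm]
        omega
      · exact absurd rfl (hy k))
    ⟨Sum.inl g₀, by simp⟩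
  let C : Finset I := Finset.univ.filter fun i => Sum.inr i ∉ σ
  have hCcol : ∀ i ∈ C, ∃ p : G, Sum.inl p ∈ σ ∧ col p = i := by
    intro i hi
    have : i ∈ σ.image (Sum.elim col id) := by rw [himg]; exact Finset.mem_univ i
    obtain ⟨p | j, hp, hpi⟩ := Finset.mem_image.1 this
    · exact ⟨p, hp, hpi⟩
    · simp only [Sum.elim_inr, id] at hpi
      subst hpi
      simp [C, hp] at hi
  have hdomC : ∀ y : G, ∃ i ∈ C, ∀ p : G, Sum.inl p ∈ σ → (y.1 i : ℕ) ≤ p.1 i := by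
    intro y
    obtain ⟨i, hi⟩ := hdom (Sum.inl y)
    refine ⟨i, ?_, fun p hp => hle i y p (hi _ hp)⟩
    simp only [C, Finset.mem_filter, Finset.mem_univ, true_and]
    intro h
    have := hi _ h
    simp [r] at this
  obtain ⟨i₁, hi₁, -⟩ := hdomC g₀
  obtain ⟨p₀, hp₀, -⟩ := hCcol i₁ hi₁
  have hmin : ∀ i, ∃ q : G, Sum.inl q ∈ σ ∧ ∀ p : G, Sum.inl p ∈ σ → (q.1 i : ℕ) ≤ p.1 i := by
    intro i
    obtain ⟨q, hq, hq'⟩ := Finset.exists_min_image (Finset.univ.filter fun p : G => Sum.inl p ∈ σ)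
      (fun p => (p.1 i : ℕ)) ⟨p₀, by simpa using hp₀⟩
    exact ⟨q, by simpa using hq, fun p hp => hq' p (by simpa using hp)⟩
  choose q hq hqmin using hmin
  let a : I → ℕ := fun i => (q i).1 i
  have hsum : N < ∑ i ∈ C, (a i + 1) := by
    by_contra hcon
    push Not at hcon
    obtain ⟨y, hy⟩ := mkG (fun i => (if i ∈ C then a i + 1 else 0) +
      if i = i₁ then N - ∑ i ∈ C, (a i + 1) else 0) (by
        rw [Finset.sum_add_distrib, Finset.sum_ite_mem, Finset.univ_inter, Finset.sum_ite_eq']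
        simp only [Finset.mem_univ, if_true]
        omega)
    obtain ⟨i, hi, hi'⟩ := hdomC y
    have := hi' _ (hq i)
    rw [hy, if_pos hi] at this
    simp only [a] at this
    omega
  have hsum' : N < ∑ i ∈ C, a i + Fintype.card I := by
    rw [Finset.sum_add_distrib, Finset.sum_const, smul_eq_mul, mul_one] at hsum
    have := Finset.card_le_univ C
    omega
  let b : I → ℕ := fun i => if i ∈ C then a i else 0
  have hb : ∀ p : G, Sum.inl p ∈ σ → ∀ i, b i ≤ p.1 i := by
    intro p hp i
    simp only [b]
    split_ifs
    · exact hqmin i p hp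
    · exact Nat.zero_le _
  have hbN : N < ∑ i, b i + Fintype.card I := by
    simpa [b, Finset.sum_ite_mem] using hsum'
  have hub : ∀ p : G, Sum.inl p ∈ σ → ∀ i, (p.1 i : ℕ) ≤ b i + Fintype.card I := by
    intro p hp i
    have h1 := Finset.add_sum_erase Finset.univ (fun i => (p.1 i : ℕ)) (Finset.mem_univ i)
    have h2 := Finset.add_sum_erase Finset.univ b (Finset.mem_univ i)
    have h3 : ∑ j ∈ Finset.univ.erase i, b j ≤ ∑ j ∈ Finset.univ.erase i, (p.1 j : ℕ) :=
      Finset.sum_le_sum fun j _ => hb p hp j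
    have h4 := p.2
    omega
  refine ⟨pt p₀, hpt p₀, fun i => ?_⟩
  by_cases hi : i ∈ C
  · obtain ⟨z, hz, hzi⟩ := hCcol i hi
    refine ⟨pt z, hpt z, ?_, ?_⟩
    · rw [dist_pi_le_iff (by positivity)]
      intro j
      rw [Real.dist_eq]
      simp only [pt]
      rw [← sub_div, abs_div, abs_of_pos hNR]
      gcongr
      have h1 := hb z hz j
      have h2 := hub z hz j
      have h3 := hb p₀ hp₀ j
      have h4 := hub p₀ hp₀ j
      rw [abs_le]
      constructor
      · rw [neg_le_sub_iff_le_add]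
        norm_cast
        omega
      · rw [sub_le_iff_le_add]
        norm_cast
        omega
    · have := hcol z
      rw [hzi] at this
      exact (sub_le_self _ (by positivity)).trans this
  · refine ⟨pt p₀, hpt p₀, by rw [dist_self]; positivity, le_trans ?_ ((hF (hpt p₀)).1 i)⟩
    rw [sub_nonpos]
    simp only [pt]
    gcongr
    have := hub p₀ hp₀ i
    simp only [b, if_neg hi] at this
    omega

/-- **Brouwer's fixed point theorem** on the standard simplex. -/
theorem exists_fixedPoint_stdSimplex {I : Type*} [Fintype I] [Nonempty I]
    {F : (I → ℝ) → I → ℝ} (hF : MapsTo F (stdSimplex ℝ I) (stdSimplex ℝ I))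
    (hFc : ContinuousOn F (stdSimplex ℝ I)) : ∃ x ∈ stdSimplex ℝ I, F x = x := by
  classical
  rcases subsingleton_or_nontrivial I with hI | hI
  · obtain ⟨i⟩ := ‹Nonempty I›
    have h := single_mem_stdSimplex ℝ i
    refine ⟨_, h, ?_⟩
    have key : ∀ y ∈ stdSimplex ℝ I, ∀ j, y j = 1 := fun y hy j => by
      rw [← hy.2, Fintype.sum_subsingleton _ j]
    ext j
    rw [key _ h, key _ (hF h)]
  choose p hp z hz hzp hzF using fun n : ℕ =>
    exists_approx_fixedPoint_stdSimplex hF (Nat.succ_pos n)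
  obtain ⟨x, hx, φ, hφ, hlim⟩ := (isCompact_stdSimplex ℝ I).tendsto_subseq hp
  have h0 : Tendsto (fun n : ℕ => (Fintype.card I : ℝ) / ((n.succ : ℕ) : ℝ)) atTop (𝓝 0) := by
    have := (tendsto_const_div_atTop_nhds_zero_nat (Fintype.card I : ℝ)).comp
      (tendsto_add_atTop_nat 1)
    exact this
  have h0φ := h0.comp hφ.tendsto_atTop
  have hle : ∀ i, x i ≤ F x i := by
    intro i
    have hzlim : Tendsto (fun n => z (φ n) i) atTop (𝓝 x) := by
      refine (tendsto_iff_of_dist ?_).2 hlim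
      exact squeeze_zero (fun _ => dist_nonneg) (fun n => hzp (φ n) i) h0φ
    have hFlim : Tendsto (fun n => F (z (φ n) i)) atTop (𝓝 (F x)) :=
      (hFc x hx).tendsto.comp
        (tendsto_nhdsWithin_iff.2 ⟨hzlim, Eventually.of_forall fun n => hz _ _⟩)
    have h1 := (tendsto_pi_nhds.1 hzlim i).sub h0φ
    rw [sub_zero] at h1
    exact le_of_tendsto_of_tendsto' h1 (tendsto_pi_nhds.1 hFlim i) fun n => hzF (φ n) i
  refine ⟨x, hx, ?_⟩
  by_contra hne
  obtain ⟨i, hi⟩ := Function.ne_iff.1 hne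
  have := Finset.sum_lt_sum (fun i _ => hle i)
    ⟨i, Finset.mem_univ i, lt_of_le_of_ne (hle i) hi.symm⟩
  rw [hx.2, (hF hx).2] at this
  exact lt_irrefl _ this

/-- **Kakutani–Fan–Glicksberg fixed point theorem**, for metrizable compact convex sets. -/
theorem exists_mem_of_isClosed_graph {V : Type*} [AddCommGroup V] [Module ℝ V] [TopologicalSpace V]
    [IsTopologicalAddGroup V] [ContinuousSMul ℝ V] [LocallyConvexSpace ℝ V] [T2Space V]
    {K : Set V} (hKc : IsCompact K) (hKconv : Convex ℝ K) (hKne : K.Nonempty)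
    [TopologicalSpace.MetrizableSpace K] {B : V → Set V} (hBK : ∀ x ∈ K, B x ⊆ K)
    (hBne : ∀ x ∈ K, (B x).Nonempty) (hBconv : ∀ x ∈ K, Convex ℝ (B x))
    (hgraph : IsClosed {p : K × K | (p.2 : V) ∈ B p.1}) : ∃ x ∈ K, x ∈ B x := by
  classical
  let _ : MetricSpace K := TopologicalSpace.metrizableSpaceMetric K
  have : CompactSpace K := isCompact_iff_compactSpace.1 hKc
  by_contra hcon
  push Not at hcon
  have hsep : ∀ x : K, ∃ (l : V →L[ℝ] ℝ) (u : ℝ), (∀ y ∈ B x, l y < u) ∧ u < l x := by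
    intro x
    have hclosed : IsClosed {y : K | (y : V) ∈ B x} :=
      hgraph.preimage (f := fun y : K => (x, y)) (by fun_prop)
    have himg : B x = Subtype.val '' {y : K | (y : V) ∈ B x} := by
      ext y
      simp only [Set.mem_image, Set.mem_ofPred_eq, Subtype.exists, exists_and_right,
        exists_eq_right]
      exact ⟨fun h => ⟨hBK x x.2 h, h⟩, fun ⟨_, h⟩ => h⟩
    have hcomp : IsCompact (B x) := by
      rw [himg]
      exact hclosed.isCompact.image continuous_subtype_val
    exact geometric_hahn_banach_closed_point (hBconv x x.2) hcomp.isClosed (hcon x x.2)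
  choose l u hlB hlx using hsep
  let c : K → Set K := fun x => {z | u x < l x z} ∩ {z | ∀ y ∈ B z, l x y < u x}
  have hcopen : ∀ x, IsOpen (c x) := by
    intro x
    refine IsOpen.inter ?_ ?_
    · exact isOpen_lt continuous_const ((l x).continuous.comp continuous_subtype_val)
    · have h1 : IsClosed {p : K × K | (p.2 : V) ∈ B p.1 ∧ u x ≤ l x p.2} :=
        hgraph.inter (isClosed_le continuous_const
          ((l x).continuous.comp (continuous_subtype_val.comp continuous_snd)))
      have h2 := isClosedMap_fst_of_compactSpace (X := K) (Y := K) _ h1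
      rw [← isOpen_compl_iff] at h2
      convert h2 using 1
      ext z
      simp only [Set.mem_ofPred_eq, Set.mem_compl_iff, Set.mem_image, Prod.exists, exists_and_right,
        exists_eq_right, not_exists, not_and, not_le]
      exact ⟨fun h y hy => h y hy, fun h y hy => h ⟨y, hBK z z.2 hy⟩ hy⟩
  have hccover : (Set.univ : Set K) ⊆ ⋃ x, c x := fun x _ =>
    Set.mem_iUnion.2 ⟨x, hlx x, hlB x⟩
  obtain ⟨δ, hδ, hleb⟩ := lebesgue_number_lemma_of_metric isCompact_univ hcopen hccover
  obtain ⟨t, -, htf, ht⟩ := (isCompact_univ (X := K)).finite_cover_balls hδ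
  have : Fintype t := htf.fintype
  have hKne' : Nonempty K := hKne.to_subtype
  have htne : Nonempty t := by
    obtain ⟨x⟩ := hKne'
    obtain ⟨i, hi, -⟩ := Set.mem_iUnion₂.1 (ht (Set.mem_univ x))
    exact ⟨⟨i, hi⟩⟩
  choose y hy using fun x : K => hBne x x.2
  let w : t → K → ℝ := fun i x => max 0 (δ - dist x i)
  have hwc : ∀ i, Continuous (w i) := fun i => by fun_prop
  have hw0 : ∀ i x, 0 ≤ w i x := fun i x => le_max_left _ _
  have hwpos : ∀ x, 0 < ∑ i, w i x := by
    intro x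
    obtain ⟨i, hi, hxi⟩ := Set.mem_iUnion₂.1 (ht (Set.mem_univ x))
    refine Finset.sum_pos' (fun i _ => hw0 i x) ⟨⟨i, hi⟩, Finset.mem_univ _, ?_⟩
    exact lt_max_of_lt_right (sub_pos.2 hxi)
  let p : K → t → ℝ := fun x i => w i x / ∑ j, w j x
  have hpc : Continuous p := continuous_pi fun i =>
    (hwc i).div (continuous_finsetSum _ fun j _ => hwc j) fun x => (hwpos x).ne'
  have hp : ∀ x, p x ∈ stdSimplex ℝ t := fun x =>
    ⟨fun i => div_nonneg (hw0 i x) (hwpos x).le, by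
      simp only [p]
      rw [← Finset.sum_div, div_self (hwpos x).ne']⟩
  have hmem : ∀ a ∈ stdSimplex ℝ t, ∑ i, a i • y i ∈ K := fun a ha =>
    hKconv.sum_mem (fun i _ => ha.1 i) ha.2 fun i _ => hBK _ i.1.2 (hy i)
  let F : (t → ℝ) → t → ℝ := fun a =>
    if h : a ∈ stdSimplex ℝ t then p ⟨∑ i, a i • y i, hmem a h⟩ else a
  have hF : MapsTo F (stdSimplex ℝ t) (stdSimplex ℝ t) := fun a ha => by
    simp only [F, dif_pos ha]
    exact hp _
  have hFc : ContinuousOn F (stdSimplex ℝ t) := by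
    rw [continuousOn_iff_continuous_domRestrict]
    have : (stdSimplex ℝ t).domRestrict F =
        fun a : stdSimplex ℝ t => p ⟨∑ i, a.1 i • y i, hmem a.1 a.2⟩ := by
      ext1 a
      simp only [Set.domRestrict_apply, F]
      rw [dif_pos a.2]
    rw [this]
    refine hpc.comp (Continuous.subtype_mk (continuous_finsetSum _ fun i _ => ?_) _)
    exact ((continuous_apply i).comp continuous_subtype_val).smul continuous_const
  obtain ⟨a, ha, hfix⟩ := exists_fixedPoint_stdSimplex hF hFc
  simp only [F, dif_pos ha] at hfix
  set x : K := ⟨∑ i, a i • y i, hmem a ha⟩ with hx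
  obtain ⟨z, hz⟩ := hleb x (Set.mem_univ _)
  have hxz : x ∈ c z := hz (Metric.mem_ball_self hδ)
  have hlt : ∀ i, a i ≠ 0 → l z (y i) < u z := by
    intro i hi
    have hi' : w i x ≠ 0 := by
      intro h
      apply hi
      rw [← hfix]
      simp only [p, h, zero_div]
    have hdist : dist x (i : K) < δ := by
      by_contra h
      exact hi' (max_eq_left (by linarith))
    have : (i : K) ∈ c z := hz (by rwa [Metric.mem_ball, dist_comm])
    exact this.2 _ (hy i)
  have h1 : l z x = ∑ i, a i * l z (y i) := by
    simp [hx, map_sum]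
  have h2 : ∑ i, a i * l z (y i) ≤ ∑ i, a i * u z := by
    refine Finset.sum_le_sum fun i _ => ?_
    by_cases hi : a i = 0
    · simp [hi]
    · exact mul_le_mul_of_nonneg_left (hlt i hi).le (ha.1 i)
  rw [← Finset.sum_mul, ha.2, one_mul, ← h1] at h2
  exact absurd hxz.1 (not_lt.2 h2)

/-- A continuous image of Baire space is, up to `ε`, the image of a compact set. -/
theorem exists_isCompact_measure_range_le {X : Type*} [TopologicalSpace X] [T2Space X]
    [MeasurableSpace X] [OpensMeasurableSpace X] (m : Measure X) [IsFiniteMeasure m]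
    {π : (ℕ → ℕ) → X} (hπ : Continuous π) {ε : ENNReal} (hε : ε ≠ 0) :
    ∃ K : Set (ℕ → ℕ), IsCompact K ∧ m (range π) ≤ m (π '' K) + ε := by
  obtain ⟨δ, hδ, hδsum⟩ := ENNReal.exists_pos_sum_of_countable' hε ℕ
  have step : ∀ (A : Set (ℕ → ℕ)) (k : ℕ), ∃ n,
      m (π '' A) ≤ m (π '' (A ∩ {z | z k ≤ n})) + δ k := by
    intro A k
    have hmono : Monotone fun n => π '' (A ∩ {z | z k ≤ n}) := fun a b hab =>
      Set.image_mono (Set.inter_subset_inter_right _ fun z hz => le_trans hz hab)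
    have hU : ⋃ n, π '' (A ∩ {z | z k ≤ n}) = π '' A := by
      rw [← Set.image_iUnion, ← Set.inter_iUnion]
      congr 1
      refine Set.inter_eq_left.2 fun z _ => Set.mem_iUnion.2 ⟨z k, le_refl (z k)⟩
    have htend := (tendsto_measure_iUnion_atTop (μ := m) hmono).add_const (δ k)
    rw [hU] at htend
    have hlt : m (π '' A) < m (π '' A) + δ k :=
      ENNReal.lt_add_right (measure_ne_top m _) (hδ k).ne'
    obtain ⟨n, hn⟩ := (htend.eventually (lt_mem_nhds hlt)).exists
    exact ⟨n, hn.le⟩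
  choose b hb using step
  let C : ℕ → Set (ℕ → ℕ) := fun k => Nat.rec Set.univ (fun k A => A ∩ {z | z k ≤ b A k}) k
  have hC : ∀ k, C (k + 1) = C k ∩ {z | z k ≤ b (C k) k} := fun k => rfl
  have hCmono : Antitone C := antitone_nat_of_succ_le fun k => by
    rw [hC]
    exact Set.inter_subset_left
  have hCm : ∀ k, m (range π) ≤ m (π '' C k) + ∑ i ∈ Finset.range k, δ i := by
    intro k
    induction k with
    | zero => simp [C]
    | succ k ih =>
      calc _ ≤ m (π '' C k) + ∑ i ∈ Finset.range k, δ i := ih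
        _ ≤ m (π '' C (k + 1)) + δ k + ∑ i ∈ Finset.range k, δ i := by
          gcongr
          exact hb _ _
        _ = _ := by rw [Finset.sum_range_succ]; ring
  let c : ℕ → ℕ := fun k => b (C k) k
  have hCc : ∀ k z, z ∈ C k ↔ ∀ i < k, z i ≤ c i := by
    intro k z
    induction k with
    | zero => simp [C]
    | succ k ih =>
      rw [hC, Set.mem_inter_iff, ih]
      simp only [Set.mem_ofPred_eq, Nat.lt_succ_iff_lt_or_eq]
      exact ⟨fun h i hi => hi.elim (h.1 i) fun e => e ▸ h.2,
        fun h => ⟨fun i hi => h i (Or.inl hi), h k (Or.inr rfl)⟩⟩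
  let K : Set (ℕ → ℕ) := Set.univ.pi fun i => Set.Iic (c i)
  have hK : IsCompact K := isCompact_univ_pi fun i => (Set.finite_Iic (c i)).isCompact
  have hsub : ⋂ k, closure (π '' C k) ⊆ π '' K := by
    intro x hx
    by_contra hxK
    obtain ⟨V, U, hV, hU, hKV, hxU, hdisj⟩ :=
      SeparatedNhds.of_isCompact_isCompact (hK.image hπ) isCompact_singleton
        (Set.disjoint_singleton_right.2 hxK)
    rw [Set.singleton_subset_iff] at hxU
    have hk : ∃ k, C k ⊆ π ⁻¹' V := by
      by_contra hcon
      push Not at hcon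
      choose z hz hzV using fun k => Set.not_subset.1 (hcon k)
      let y : ℕ → ℕ → ℕ := fun k i => min (z k i) (c i)
      obtain ⟨l, hl, ψ, hψ, hlim⟩ := hK.isSeqCompact (x := y)
        fun k i _ => Set.mem_Iic.2 (min_le_right (z k i) (c i))
      have hlim' : Tendsto (fun k => z (ψ k)) atTop (𝓝 l) := by
        rw [tendsto_pi_nhds] at hlim ⊢
        intro i
        refine (hlim i).congr' ?_
        filter_upwards [eventually_gt_atTop i] with k hk
        exact min_eq_left ((hCc _ _).1 (hz (ψ k)) i (hk.trans_le (hψ.id_le k)))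
      have : ∀ᶠ k in atTop, z (ψ k) ∈ π ⁻¹' V :=
        hlim'.eventually ((hV.preimage hπ).mem_nhds (hKV (Set.mem_image_of_mem _ hl)))
      obtain ⟨k, hk⟩ := this.exists
      exact hzV _ hk
    obtain ⟨k, hk⟩ := hk
    obtain ⟨w, hwU, z, hz, rfl⟩ := mem_closure_iff.1 (Set.mem_iInter.1 hx k) U hU hxU
    exact Set.disjoint_left.1 hdisj (hk hz) hwU
  refine ⟨K, hK, ?_⟩
  have htend := tendsto_measure_iInter_atTop (μ := m) (s := fun k => closure (π '' C k))
    (fun k => isClosed_closure.measurableSet.nullMeasurableSet)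
    (fun i j hij => closure_mono (Set.image_mono (hCmono hij))) ⟨0, measure_ne_top _ _⟩
  have hle : m (range π) ≤ m (⋂ k, closure (π '' C k)) + ε := by
    refine ge_of_tendsto' (htend.add_const ε) fun k => ?_
    refine (hCm k).trans (add_le_add (measure_mono subset_closure) ?_)
    exact (ENNReal.sum_le_tsum _).trans hδsum.le
  exact hle.trans (by gcongr)

/-- Analytic sets are universally measurable. -/
theorem MeasureTheory.AnalyticSet.nullMeasurableSet {X : Type*} [TopologicalSpace X] [T2Space X]
    [MeasurableSpace X] [OpensMeasurableSpace X] (m : Measure X) [IsFiniteMeasure m]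
    {s : Set X} (hs : AnalyticSet s) : NullMeasurableSet s m := by
  rw [AnalyticSet] at hs
  obtain rfl | ⟨π, hπ, rfl⟩ := hs
  · exact nullMeasurableSet_empty
  choose K hK hKm using fun n : ℕ => exists_isCompact_measure_range_le m hπ
    (ε := ((n : ENNReal) + 1)⁻¹) (by simp)
  have hmeas : MeasurableSet (⋃ n, π '' K n) :=
    MeasurableSet.iUnion fun n => ((hK n).image hπ).measurableSet
  have hle : m (range π) ≤ m (⋃ n, π '' K n) := by
    have h0 : Tendsto (fun n : ℕ => m (⋃ n, π '' K n) + ((n : ENNReal) + 1)⁻¹) atTop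
        (𝓝 (m (⋃ n, π '' K n) + 0)) := by
      refine tendsto_const_nhds.add ?_
      have := (tendsto_add_atTop_iff_nat 1).2 ENNReal.tendsto_inv_nat_nhds_zero
      simpa using this
    rw [add_zero] at h0
    refine ge_of_tendsto' h0 fun n => (hKm n).trans ?_
    gcongr
    exact Set.subset_iUnion (fun n => π '' K n) n
  have := ae_eq_of_subset_of_measure_ge (Set.iUnion_subset fun n => Set.image_subset_range π (K n))
    hle hmeas.nullMeasurableSet (measure_ne_top _ _)
  exact hmeas.nullMeasurableSet.congr this

/-- A measurable subset of a product is a preimage of a Borel set of `(ℕ → Bool) × E`. -/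
theorem exists_measurable_preimage_prodMap {T E : Type*} [MeasurableSpace T] [MeasurableSpace E]
    {G : Set (T × E)} (hG : MeasurableSet G) :
    ∃ i : T → ℕ → Bool, Measurable i ∧ ∃ B : Set ((ℕ → Bool) × E), MeasurableSet B ∧
      G = (fun p : T × E => (i p.1, p.2)) ⁻¹' B := by
  classical
  have hgen : (inferInstance : MeasurableSpace (T × E)) =
    MeasurableSpace.generateFrom (image2 (· ×ˢ ·)
      {s : Set T | MeasurableSet s} {t : Set E | MeasurableSet t}) :=
    generateFrom_prod.symm
  induction G, hG using MeasurableSpace.induction_on_inter hgen isPiSystem_prod with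
  | empty => exact ⟨fun _ _ => false, measurable_const, ∅, MeasurableSet.empty, by simp⟩
  | basic t ht =>
    obtain ⟨A, hA, D, hD, rfl⟩ := ht
    refine ⟨fun t _ => decide (t ∈ A), measurable_pi_lambda _ fun _ => ?_,
      {p | p.1 0 = true ∧ p.2 ∈ D}, ?_, ?_⟩
    · refine measurable_to_bool ?_
      have : (fun t => decide (t ∈ A)) ⁻¹' {true} = A := by
        ext
        simp
      rw [this]
      exact hA
    · refine MeasurableSet.inter ?_ (measurable_snd hD)
      have h0 : Measurable fun p : (ℕ → Bool) × E => p.1 0 :=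
        (measurable_pi_apply 0).comp measurable_fst
      exact h0 (measurableSet_singleton true)
    · ext; simp
  | compl t ht ih =>
    obtain ⟨i, hi, B, hB, rfl⟩ := ih
    exact ⟨i, hi, Bᶜ, hB.compl, rfl⟩
  | iUnion f _ hf ih =>
    choose i hi B hB hfB using ih
    refine ⟨fun t n => i n.unpair.1 t n.unpair.2, ?_,
      ⋃ k, (fun p : (ℕ → Bool) × E => ((fun n => p.1 (Nat.pair k n)), p.2)) ⁻¹' B k, ?_, ?_⟩
    · exact measurable_pi_lambda _ fun n => (measurable_pi_apply _).comp (hi _)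
    · refine MeasurableSet.iUnion fun k => ?_
      refine (Measurable.prodMk (measurable_pi_lambda _ fun n => ?_) measurable_snd) (hB k)
      exact (measurable_pi_apply _).comp measurable_fst
    · rw [Set.preimage_iUnion]
      refine Set.iUnion_congr fun k => ?_
      rw [hfB k]
      ext p
      simp

/-- Given countably many measurable sets, choose measurably the index of one containing `t`. -/
theorem exists_measurable_nat_selection {T : Type*} [MeasurableSpace T] {A : ℕ → Set T}
    (hA : ∀ k, MeasurableSet (A k)) :
    ∃ g : T → ℕ, Measurable g ∧ ∀ t k, t ∈ A k → t ∈ A (g t) := by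
  classical
  have hex : ∀ t, ∃ k, t ∈ A k ∨ ∀ j, t ∉ A j := by
    intro t
    by_cases h : ∃ k, t ∈ A k
    · exact h.imp fun k hk => Or.inl hk
    · exact ⟨0, Or.inr fun j hj => h ⟨j, hj⟩⟩
  refine ⟨fun t => Nat.find (hex t), measurable_find hex fun k => ?_, fun t k hk => ?_⟩
  · have : {t | ∀ j, t ∉ A j} = ⋂ j, (A j)ᶜ := by
      ext
      simp
    refine (hA k).union (s₂ := {t | ∀ j, t ∉ A j}) ?_
    rw [this]
    exact MeasurableSet.iInter fun j => (hA j).compl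
  · exact (Nat.find_spec (hex t)).resolve_right fun h => h k hk

/-- **Measurable projection and measurable selection**, over a complete finite measure space. -/
theorem exists_measurable_selection {T E : Type*} [MeasurableSpace T] (μ : Measure T)
    [IsFiniteMeasure μ] [μ.IsComplete] [TopologicalSpace E] [PolishSpace E] [MeasurableSpace E]
    [BorelSpace E] [Nonempty E] {G : Set (T × E)} (hG : MeasurableSet G) :
    MeasurableSet (Prod.fst '' G) ∧
      ∃ f : T → E, Measurable f ∧ ∀ t ∈ Prod.fst '' G, (t, f t) ∈ G := by
  have : TopologicalSpace.IsCompletelyMetrizableSpace (ℕ → Bool) := inferInstance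
  have : PolishSpace (ℕ → Bool) := inferInstance
  obtain ⟨i, hi, B, hB, rfl⟩ := exists_measurable_preimage_prodMap hG
  have hBan := hB.analyticSet
  rw [AnalyticSet] at hBan
  obtain rfl | ⟨φ, hφ, rfl⟩ := hBan
  · exact ⟨by simp, fun _ => Classical.arbitrary E, measurable_const, by simp⟩
  let cyl : List ℕ → Set (ℕ → ℕ) := fun u => {z | ∀ k < u.length, z k = u.getD k 0}
  let A : List ℕ → Set T := fun u => i ⁻¹' ((fun z => (φ z).1) '' cyl u)
  have hA : ∀ u, MeasurableSet (A u) := by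
    intro u
    have hcyl : IsOpen (cyl u) := by
      have : cyl u = ⋂ k ∈ Finset.range u.length, (fun z : ℕ → ℕ => z k) ⁻¹' {u.getD k 0} := by
        ext z
        simp [cyl]
      rw [this]
      exact isOpen_biInter_finset fun k _ => (isOpen_discrete _).preimage (continuous_apply k)
    have h1 : AnalyticSet ((fun z => (φ z).1) '' cyl u) :=
      hcyl.analyticSet_image (continuous_fst.comp hφ)
    have h2 := (h1.nullMeasurableSet (μ.map i)).preimage
      (Measure.QuasiMeasurePreserving.mk hi Measure.AbsolutelyContinuous.rfl)
    exact h2.measurable_of_complete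
  have hAstep : ∀ u t, t ∈ A u → ∃ k, t ∈ A (u ++ [k]) := by
    rintro u t ⟨z, hz, hzt⟩
    refine ⟨z u.length, z, fun k hk => ?_, hzt⟩
    rw [List.length_append, List.length_singleton, Nat.lt_succ_iff_lt_or_eq] at hk
    rcases hk with hk | rfl
    · rw [hz k hk, List.getD_append _ _ _ _ hk]
    · rw [List.getD_append_right _ _ _ _ le_rfl]
      simp
  have hfst : Prod.fst '' ((fun p : T × E => (i p.1, p.2)) ⁻¹' range φ) = A [] := by
    ext t
    constructor
    · rintro ⟨p, ⟨z, hz⟩, rfl⟩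
      exact ⟨z, by simp [cyl], by simp [hz]⟩
    · rintro ⟨z, -, hz⟩
      exact ⟨(t, (φ z).2), ⟨z, by simp [← hz]⟩, rfl⟩
  rw [hfst]
  refine ⟨hA [], ?_⟩
  choose g hg hgA using fun u => exists_measurable_nat_selection fun k => hA (u ++ [k])
  let p : ℕ → T → List ℕ := fun n t => Nat.rec [] (fun _ u => u ++ [g u t]) n
  have hp : ∀ n t, p (n + 1) t = p n t ++ [g (p n t) t] := fun n t => rfl
  have hplen : ∀ n t, (p n t).length = n := by
    intro n t
    induction n with
    | zero => rfl
    | succ n ih => simp [hp, ih]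
  let _ : MeasurableSpace (List ℕ) := ⊤
  have hpm : ∀ n, Measurable (p n) := by
    intro n
    induction n with
    | zero => exact measurable_const
    | succ n ih =>
      have h1 : Measurable fun q : List ℕ × T => q.1 ++ [g q.1 q.2] :=
        measurable_from_prod_countable_right fun u =>
          (measurable_of_countable fun k : ℕ => u ++ [k]).comp (hg u)
      exact h1.comp (ih.prodMk measurable_id)
  let s : T → ℕ → ℕ := fun t k => g (p k t) t
  have hs : Measurable s := by
    refine measurable_pi_lambda _ fun k => ?_
    have h1 : Measurable fun q : List ℕ × T => g q.1 q.2 :=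
      measurable_from_prod_countable_right hg
    exact h1.comp ((hpm k).prodMk measurable_id)
  have hps : ∀ n t, ∀ k < n, (p n t).getD k 0 = s t k := by
    intro n t
    induction n with
    | zero => intro k hk; omega
    | succ n ih =>
      intro k hk
      rw [hp]
      rcases Nat.lt_succ_iff_lt_or_eq.1 hk with hk | rfl
      · rw [List.getD_append _ _ _ _ (by rwa [hplen]), ih k hk]
      · rw [List.getD_append_right _ _ _ _ (hplen k t).le]
        simp [hplen, s]
  refine ⟨fun t => (φ (s t)).2, (continuous_snd.comp hφ).measurable.comp hs, fun t ht => ?_⟩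
  have hpA : ∀ n, t ∈ A (p n t) := by
    intro n
    induction n with
    | zero => exact ht
    | succ n ih =>
      obtain ⟨k, hk⟩ := hAstep _ _ ih
      exact hgA (p n t) t k hk
  choose z hz hzt using hpA
  have hlim : Tendsto z atTop (𝓝 (s t)) := by
    rw [tendsto_pi_nhds]
    intro k
    refine tendsto_const_nhds.congr' ?_
    filter_upwards [eventually_gt_atTop k] with n hn
    rw [hz n k (by rwa [hplen]), hps n t k hn]
  have hlim' := ((continuous_fst.comp hφ).tendsto (s t)).comp hlim
  have : (φ (s t)).1 = i t := tendsto_nhds_unique hlim'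
    (tendsto_const_nhds.congr fun n => (hzt n).symm)
  exact ⟨s t, by simp [← this]⟩

/-- A finite measure on an essentially countably generated measurable space is separable. -/
theorem MeasureTheory.IsSeparable.of_generateFrom_union_null {T : Type*} [m0 : MeasurableSpace T]
    (μ : Measure T) [IsFiniteMeasure μ]
    (h : ∃ c : Set (Set T), c.Countable ∧
      m0 = MeasurableSpace.generateFrom (c ∪ {s : Set T | μ s = 0})) : IsSeparable μ := by
  obtain ⟨c, hc, hgen⟩ := h
  have hcm : ∀ s ∈ c, MeasurableSet s := fun s hs => by
    rw [hgen]
    exact MeasurableSpace.measurableSet_generateFrom (Or.inl hs)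
  have hle : MeasurableSpace.generateFrom c ≤ m0 := MeasurableSpace.generateFrom_le hcm
  have key : ∀ s, MeasurableSet s → ∃ t, MeasurableSet[MeasurableSpace.generateFrom c] t ∧
      s =ᵐ[μ] t := by
    intro s hs
    rw [hgen] at hs
    induction s, hs using MeasurableSpace.generateFrom_induction with
    | hC t ht _ =>
      rcases ht with ht | ht
      · exact ⟨t, MeasurableSpace.measurableSet_generateFrom ht, Filter.EventuallyEq.rfl⟩
      · exact ⟨∅, @MeasurableSet.empty _ (_), ae_eq_empty.2 ht⟩
    | empty => exact ⟨∅, @MeasurableSet.empty _ (_), Filter.EventuallyEq.rfl⟩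
    | compl t _ ih =>
      obtain ⟨u, hu, htu⟩ := ih
      exact ⟨uᶜ, hu.compl, htu.compl⟩
    | iUnion f _ ih =>
      choose u hu hfu using ih
      exact ⟨⋃ n, u n, MeasurableSet.iUnion hu, Filter.EventuallyEq.countable_iUnion hfu⟩
  refine ⟨generateSetAlgebra c, countable_generateSetAlgebra hc, ?_, ?_⟩
  · intro s hs
    apply hle
    rw [← generateFrom_generateSetAlgebra_eq]
    exact MeasurableSpace.measurableSet_generateFrom hs
  · intro s hs _ ε hε
    obtain ⟨t, ht, hst⟩ := key s hs
    have hdense := @Measure.MeasureDense.of_generateFrom_isSetAlgebra_finite T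
      (MeasurableSpace.generateFrom c) (μ.trim hle) (generateSetAlgebra c) _
      isSetAlgebra_generateSetAlgebra generateFrom_generateSetAlgebra_eq.symm
    obtain ⟨u, hu, htu⟩ := @Measure.MeasureDense.approx _ (_) _ _ hdense t ht
      (measure_ne_top _ _) ε hε
    refine ⟨u, hu, ?_⟩
    rw [trim_measurableSet_eq hle (ht.symmDiff
      (@Measure.MeasureDense.measurable _ (_) _ _ hdense u hu))] at htu
    rwa [measure_congr (hst.symmDiff (Filter.EventuallyEq.rfl (f := u)))]

/-- A convex closed set in a normed space is weakly sequentially closed. -/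
theorem Convex.mem_of_weakly_tendsto {H : Type*} [NormedAddCommGroup H] [NormedSpace ℝ H]
    {C : Set H} (hC : Convex ℝ C) (hCc : IsClosed C) {x : ℕ → H} {y : H}
    (hx : ∃ᶠ k in atTop, x k ∈ C)
    (hlim : ∀ l : H →L[ℝ] ℝ, Tendsto (fun k => l (x k)) atTop (𝓝 (l y))) : y ∈ C := by
  by_contra hy
  obtain ⟨l, u, hlu, hul⟩ := geometric_hahn_banach_closed_point hC hCc hy
  obtain ⟨k, hk, hk'⟩ := (hx.and_eventually ((hlim l).eventually (lt_mem_nhds hul))).exists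
  exact lt_asymm (hlu _ hk) hk'

/-- A Kakutani fixed point theorem for weakly sequentially closed correspondences on bounded closed
convex subsets of a separable Hilbert space. -/
theorem exists_mem_of_weakly_closed_graph {H : Type*} [NormedAddCommGroup H]
    [InnerProductSpace ℝ H] [CompleteSpace H] [TopologicalSpace.SeparableSpace H] {K : Set H}
    (hKb : Bornology.IsBounded K) (hKc : IsClosed K) (hKconv : Convex ℝ K) (hKne : K.Nonempty)
    {B : H → Set H} (hBK : ∀ x ∈ K, B x ⊆ K) (hBne : ∀ x ∈ K, (B x).Nonempty)
    (hBconv : ∀ x ∈ K, Convex ℝ (B x))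
    (hgraph : ∀ (x y : ℕ → H) (a b : H), a ∈ K → b ∈ K → (∀ k, x k ∈ K) → (∀ k, y k ∈ B (x k)) →
      (∀ l : H →L[ℝ] ℝ, Tendsto (fun k => l (x k)) atTop (𝓝 (l a))) →
      (∀ l : H →L[ℝ] ℝ, Tendsto (fun k => l (y k)) atTop (𝓝 (l b))) → b ∈ B a) :
    ∃ x ∈ K, x ∈ B x := by
  let e : H ≃ₗ[ℝ] WeakDual ℝ H :=
    (InnerProductSpace.toDual ℝ H).toLinearEquiv.trans StrongDual.toWeakDual
  have he : ∀ x y, e x y = inner ℝ x y := fun x y => rfl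
  have hweak : ∀ {x : ℕ → H} {a : H}, Tendsto (fun k => e (x k)) atTop (𝓝 (e a)) →
      ∀ l : H →L[ℝ] ℝ, Tendsto (fun k => l (x k)) atTop (𝓝 (l a)) := by
    intro x a h l
    have h1 :=
      (WeakDual.eval_continuous ((InnerProductSpace.toDual ℝ H).symm l)).tendsto _ |>.comp h
    have h2 : ∀ z, e z ((InnerProductSpace.toDual ℝ H).symm l) = l z := fun z => by
      rw [he, real_inner_comm, InnerProductSpace.toDual_symm_apply]
    simpa [Function.comp_def, h2] using h1
  have hcl : IsClosed (e '' K) := by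
    rw [← isOpen_compl_iff, isOpen_iff_mem_nhds]
    intro w hw
    obtain ⟨y, rfl⟩ := e.surjective w
    have hy : y ∉ K := fun h => hw ⟨y, h, rfl⟩
    obtain ⟨l, u, hlu, hul⟩ := geometric_hahn_banach_closed_point hKconv hKc hy
    have h2 : ∀ z, e z ((InnerProductSpace.toDual ℝ H).symm l) = l z := fun z => by
      rw [he, real_inner_comm, InnerProductSpace.toDual_symm_apply]
    have hopen : IsOpen {w : WeakDual ℝ H | u < w ((InnerProductSpace.toDual ℝ H).symm l)} :=
      isOpen_lt continuous_const (WeakDual.eval_continuous _)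
    filter_upwards [hopen.mem_nhds (show u < _ by rwa [h2])] with w hw
    rintro ⟨z, hz, rfl⟩
    have : u < e z ((InnerProductSpace.toDual ℝ H).symm l) := hw
    rw [h2] at this
    exact lt_asymm (hlu z hz) this
  have hcomp : IsCompact (e '' K) := by
    obtain ⟨r, hr⟩ := hKb.subset_closedBall 0
    refine (WeakDual.isCompact_closedBall (𝕜 := ℝ) (E := H) 0 r).of_isClosed_subset hcl ?_
    rintro _ ⟨z, hz, rfl⟩
    have : ‖z‖ ≤ r := by simpa using hr hz
    rw [Set.mem_preimage, mem_closedBall_zero_iff]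
    exact ((InnerProductSpace.toDual ℝ H).norm_map z).trans_le this
  have : TopologicalSpace.MetrizableSpace (e '' K) := WeakDual.metrizable_of_isCompact ℝ H _ hcomp
  have : LocallyConvexSpace ℝ (WeakDual ℝ H) :=
    inferInstanceAs (LocallyConvexSpace ℝ (WeakBilin (topDualPairing ℝ H)))
  obtain ⟨w, ⟨x, hx, rfl⟩, hw⟩ := exists_mem_of_isClosed_graph (V := WeakDual ℝ H) hcomp
    (hKconv.linear_image e.toLinearMap) (hKne.image e) (B := fun w => e '' B (e.symm w))
    (by
      rintro _ ⟨x, hx, rfl⟩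
      simpa using Set.image_mono (f := e) (hBK x hx))
    (by
      rintro _ ⟨x, hx, rfl⟩
      simpa using hBne x hx)
    (by
      rintro _ ⟨x, hx, rfl⟩
      rw [e.symm_apply_apply]
      exact (hBconv x hx).linear_image e.toLinearMap)
    (by
      refine IsSeqClosed.isClosed ?_
      rintro p ⟨⟨_, a, ha, rfl⟩, ⟨_, b, hb, rfl⟩⟩ hp hlim
      rw [Prod.tendsto_iff] at hlim
      have h1 := (continuous_subtype_val.tendsto _).comp hlim.1
      have h2 := (continuous_subtype_val.tendsto _).comp hlim.2
      have hx : ∀ k, e (e.symm (p k).1) = (p k).1 := fun k => e.apply_symm_apply _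
      have hy : ∀ k, e (e.symm (p k).2) = (p k).2 := fun k => e.apply_symm_apply _
      have := hgraph (fun k => e.symm (p k).1) (fun k => e.symm (p k).2) a b ha hb ?_ ?_
        (hweak (by simpa only [hx, Function.comp_def] using h1))
        (hweak (by simpa only [hy, Function.comp_def] using h2))
      · simpa using this
      · intro k
        obtain ⟨z, hz, hzk⟩ := (p k).1.2
        simpa [← hzk] using hz
      · intro k
        obtain ⟨z, hz, hzk⟩ := hp k
        simpa [← hzk] using hz)
  rw [e.symm_apply_apply] at hw
  obtain ⟨z, hz, hzx⟩ := hw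
  exact ⟨x, hx, e.injective hzx ▸ hz⟩

theorem separableSpace_lp_two : TopologicalSpace.SeparableSpace (lp (fun _ : ℕ => ℝ) 2) := by
  have hsep : TopologicalSpace.IsSeparable
      (Submodule.span ℝ (range fun n : ℕ => lp.single (E := fun _ : ℕ => ℝ) 2 n (1 : ℝ)) :
        Set (lp (fun _ : ℕ => ℝ) 2)) :=
    (countable_range _).isSeparable.span
  rw [← TopologicalSpace.isSeparable_univ_iff]
  refine hsep.closure.mono fun f _ => ?_
  refine mem_closure_of_tendsto (lp.hasSum_single (by simp) f) (Eventually.of_forall fun s => ?_)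
  refine Submodule.sum_mem _ fun i _ => ?_
  have : lp.single (E := fun _ : ℕ => ℝ) 2 i (f i) =
      f i • lp.single (E := fun _ : ℕ => ℝ) 2 i (1 : ℝ) := by
    rw [← lp.single_smul, smul_eq_mul, mul_one]
  rw [this]
  exact Submodule.smul_mem _ _ (Submodule.subset_span ⟨i, rfl⟩)

theorem exists_seq_dual_separating (E : Type*) [NormedAddCommGroup E] [NormedSpace ℝ E]
    [TopologicalSpace.SeparableSpace E] :
    ∃ g : ℕ → E →L[ℝ] ℝ, (∀ n, ‖g n‖ ≤ 1) ∧ ∀ x, (∀ n, g n x = 0) → x = 0 := by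
  choose g hg hgd using fun n => exists_dual_vector'' ℝ (TopologicalSpace.denseSeq E n)
  refine ⟨g, hg, fun x hx => ?_⟩
  by_contra hne
  have hpos : 0 < ‖x‖ / 2 := half_pos (norm_pos_iff.2 hne)
  obtain ⟨n, hn⟩ := (TopologicalSpace.denseRange_denseSeq E).exists_dist_lt x hpos
  set d := TopologicalSpace.denseSeq E n
  rw [dist_eq_norm] at hn
  have h1 : ‖g n (x - d)‖ ≤ ‖x - d‖ := by
    simpa using (g n).le_of_opNorm_le (hg n) (x - d)
  have h2 : ‖x‖ ≤ ‖x - d‖ + ‖d‖ := by simpa using norm_add_le (x - d) d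
  rw [map_sub, hx n, zero_sub, norm_neg, hgd n] at h1
  simp only [RCLike.ofReal_real_eq_id, id_eq, norm_norm] at h1
  linarith

/-- A separable Banach space embeds into a Hilbert space by an injective operator which is weak to
norm continuous on bounded sets. -/
theorem exists_injective_weak_norm_continuousOn (E : Type*) [NormedAddCommGroup E]
    [NormedSpace ℝ E] [TopologicalSpace.SeparableSpace E] :
    ∃ J : E →L[ℝ] lp (fun _ : ℕ => ℝ) 2, Function.Injective J ∧
      ∀ r, ContinuousOn (fun a : WeakSpace ℝ E => J ((toWeakSpace ℝ E).symm a))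
        (toWeakSpace ℝ E '' Metric.closedBall 0 r) := by
  obtain ⟨g, hg, hgs⟩ := exists_seq_dual_separating E
  let v : ℕ → lp (fun _ : ℕ => ℝ) 2 := fun n =>
    lp.single (E := fun _ : ℕ => ℝ) 2 n ((1 / 2 : ℝ) ^ n)
  have hv : ∀ n, ‖v n‖ = (1 / 2 : ℝ) ^ n := fun n => by
    simp only [v]
    rw [lp.norm_single (by simp)]
    simp
  let J : E →L[ℝ] lp (fun _ : ℕ => ℝ) 2 := ∑' n, (g n).smulRight (v n)
  have hle : ∀ n, ‖(g n).smulRight (v n)‖ ≤ (1 / 2 : ℝ) ^ n := fun n => by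
    rw [ContinuousLinearMap.norm_smulRight_apply, hv]
    exact mul_le_of_le_one_left (by positivity) (hg n)
  have hsum : Summable fun n => (g n).smulRight (v n) :=
    Summable.of_norm_bounded summable_geometric_two hle
  have hJ : ∀ a, HasSum (fun n => g n a • v n) (J a) := fun a => by
    have := hsum.hasSum.mapL (ContinuousLinearMap.apply ℝ (lp (fun _ : ℕ => ℝ) 2) a)
    simpa using this
  refine ⟨J, ?_, fun r => ?_⟩
  · rw [injective_iff_map_eq_zero]
    intro a ha
    refine hgs a fun n => ?_
    have h1 := (hJ a).mapL (lp.evalCLM ℝ (fun _ : ℕ => ℝ) 2 n)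
    rw [ha, map_zero] at h1
    have h2 := h1.unique (hasSum_single n fun k hk => by
      simp [v, lp.evalCLM, hk.symm])
    simpa [v, lp.evalCLM] using h2.symm
  · have hJ' : (fun a : WeakSpace ℝ E => J ((toWeakSpace ℝ E).symm a)) =
        fun a => ∑' n, g n ((toWeakSpace ℝ E).symm a) • v n := by
      ext1 a
      exact (hJ _).tsum_eq.symm
    rw [hJ']
    refine continuousOn_tsum (u := fun n => |r| * (1 / 2 : ℝ) ^ n) (fun n => ?_)
      (summable_geometric_two.mul_left _) ?_
    · exact ((WeakBilin.eval_continuous _ (g n)).smul continuous_const).continuousOn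
    · rintro n _ ⟨a, ha, rfl⟩
      rw [LinearEquiv.symm_apply_apply, norm_smul, hv]
      gcongr
      rw [mem_closedBall_zero_iff] at ha
      calc ‖g n a‖ ≤ 1 * ‖a‖ := (g n).le_of_opNorm_le (hg n) a
        _ ≤ |r| := by rw [one_mul]; exact ha.trans (le_abs_self r)

theorem convex_setOf_ae_mem {T ℋ : Type*} [MeasurableSpace T] {μ : Measure T}
    [NormedAddCommGroup ℋ] [NormedSpace ℝ ℋ] {p : ENNReal} {D : T → Set ℋ}
    (hD : ∀ᵐ t ∂μ, Convex ℝ (D t)) :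
    Convex ℝ {z : Lp ℋ p μ | ∀ᵐ t ∂μ, z t ∈ D t} := by
  intro x hx y hy a b ha hb hab
  filter_upwards [hD, hx, hy, Lp.coeFn_add (a • x) (b • y), Lp.coeFn_smul a x, Lp.coeFn_smul b y]
    with t hDt hxt hyt h1 h2 h3
  rw [h1, Pi.add_apply, h2, h3]
  exact hDt hxt hyt ha hb hab

theorem Lp.exists_subseq_tendsto_ae {T ℋ : Type*} [MeasurableSpace T] {μ : Measure T}
    [NormedAddCommGroup ℋ] {p : ENNReal} [Fact (1 ≤ p)] {x : ℕ → Lp ℋ p μ} {a : Lp ℋ p μ}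
    (hx : Tendsto x atTop (𝓝 a)) :
    ∃ ψ : ℕ → ℕ, StrictMono ψ ∧ ∀ᵐ t ∂μ, Tendsto (fun k => x (ψ k) t) atTop (𝓝 (a t)) :=
  (tendstoInMeasure_of_tendsto_Lp hx).exists_seq_tendsto_ae

theorem isClosed_setOf_ae_mem {T ℋ : Type*} [MeasurableSpace T] {μ : Measure T}
    [NormedAddCommGroup ℋ] {p : ENNReal} [Fact (1 ≤ p)] {D : T → Set ℋ}
    (hD : ∀ᵐ t ∂μ, IsClosed (D t)) :
    IsClosed {z : Lp ℋ p μ | ∀ᵐ t ∂μ, z t ∈ D t} := by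
  refine IsSeqClosed.isClosed fun x a hx hlim => ?_
  obtain ⟨ψ, -, hψ⟩ := Lp.exists_subseq_tendsto_ae hlim
  filter_upwards [hD, hψ, ae_all_iff.2 hx] with t hDt ht hxt
  exact hDt.mem_of_tendsto ht (Eventually.of_forall fun k => hxt _)

/-- The maximizers of `u` on `C`. -/
def maximizers {E : Type*} (C : Set E) (u : E → ℝ) : Set E := {a ∈ C | ∀ b ∈ C, u b ≤ u a}

/-- **Measurable maximum theorem** for graph measurable constraints. -/
theorem exists_measurable_maximizer {T E : Type*} [MeasurableSpace T] (μ : Measure T)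
    [IsFiniteMeasure μ] [μ.IsComplete] [TopologicalSpace E] [PolishSpace E] [MeasurableSpace E]
    [BorelSpace E] {S : T → Set E} (hS : MeasurableSet {p : T × E | p.2 ∈ S p.1})
    {u : T → E → ℝ} (hu : Measurable fun p : {q : T × E // q.2 ∈ S q.1} => u p.1.1 p.1.2)
    (hne : ∀ t, (maximizers (S t) (u t)).Nonempty) :
    ∃ f : T → E, Measurable f ∧ ∀ t, f t ∈ maximizers (S t) (u t) := by
  obtain hT | ⟨⟨t₀⟩⟩ := isEmpty_or_nonempty T
  · exact ⟨fun t => (hT.false t).elim, measurable_of_empty _, fun t => (hT.false t).elim⟩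
  have : Nonempty E := ⟨(hne t₀).some⟩
  have hemb := MeasurableEmbedding.subtype_coe hS
  let G : ℚ → Set (T × E) := fun q =>
    Subtype.val '' {p : {q : T × E // q.2 ∈ S q.1} | (q : ℝ) < u p.1.1 p.1.2}
  let G' : ℚ → Set (T × E) := fun q =>
    Subtype.val '' {p : {q : T × E // q.2 ∈ S q.1} | (q : ℝ) ≤ u p.1.1 p.1.2}
  have hG : ∀ q, MeasurableSet (G q) := fun q =>
    hemb.measurableSet_image.2 (measurableSet_lt measurable_const hu)
  have hG' : ∀ q, MeasurableSet (G' q) := fun q =>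
    hemb.measurableSet_image.2 (measurableSet_le measurable_const hu)
  have hP : ∀ q, MeasurableSet (Prod.fst '' G q) := fun q =>
    (exists_measurable_selection μ (hG q)).1
  let M : Set (T × E) :=
    {p | p.2 ∈ S p.1} ∩ ⋂ q, ((Prod.fst ⁻¹' (Prod.fst '' G q))ᶜ ∪ G' q)
  have hM : MeasurableSet M :=
    hS.inter (MeasurableSet.iInter fun q => (measurable_fst (hP q)).compl.union (hG' q))
  have hMmem : ∀ t a, (t, a) ∈ M ↔ a ∈ maximizers (S t) (u t) := by
    intro t a
    simp only [M, G, G', maximizers, Set.mem_inter_iff, Set.mem_iInter, Set.mem_union,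
      Set.mem_compl_iff, Set.mem_preimage, Set.mem_image, Set.mem_ofPred_eq, Subtype.exists,
      exists_and_right, exists_eq_right, Prod.exists]
    refine and_congr_right fun ha => ⟨fun h b hb => ?_, fun h q => ?_⟩
    · by_contra hlt
      push Not at hlt
      obtain ⟨q, hq, hq'⟩ := exists_rat_btwn hlt
      rcases h q with h | h
      · exact h ⟨b, hb, hq'⟩
      · exact absurd h.2 (not_le.2 hq)
    · by_cases hq : (q : ℝ) ≤ u t a
      · exact Or.inr ⟨ha, hq⟩
      · refine Or.inl ?_
        rintro ⟨b, hb, hqb⟩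
        exact hq (hqb.le.trans (h b hb))
  obtain ⟨-, f, hf, hfM⟩ := exists_measurable_selection μ hM
  refine ⟨f, hf, fun t => (hMmem t _).1 (hfM t ?_)⟩
  obtain ⟨a, ha⟩ := hne t
  exact ⟨(t, a), (hMmem t a).2 ha, rfl⟩

/-- Carathéodory functions are superpositionally measurable. -/
theorem measurable_apply_of_forall_tendsto {P T X : Type*} [MeasurableSpace P] [MeasurableSpace T]
    [TopologicalSpace X] {V : P → X → ℝ} {π : P → T} (hπ : Measurable π)
    (hVm : ∀ e, Measurable fun p => V p e) (hVc : ∀ p, Continuous (V p))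
    {e : T → X} (he : StronglyMeasurable e) : Measurable fun p => V p (e (π p)) := by
  obtain ⟨s, hs⟩ := he
  refine measurable_of_tendsto_metrizable (f := fun n p => V p (s n (π p))) (fun n => ?_) ?_
  · exact SimpleFunc.measurable_bind ((s n).comp π hπ) (fun e p => V p e) hVm
  · rw [tendsto_pi_nhds]
    exact fun p => ((hVc p).tendsto _).comp (hs (π p))

section WeaklyCompact

variable {E ℋ : Type*} [NormedAddCommGroup E] [NormedSpace ℝ E] [NormedAddCommGroup ℋ]

theorem isCompact_image_of_weak {C : Set E} (hC : IsCompact (toWeakSpace ℝ E '' C)) {L : E → ℋ}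
    (hL : ContinuousOn (fun a : WeakSpace ℝ E => L ((toWeakSpace ℝ E).symm a))
      (toWeakSpace ℝ E '' C)) : IsCompact (L '' C) := by
  have := hC.image_of_continuousOn hL
  simpa [Set.image_image] using this

/-- On a weakly compact set, the inverse of an injective weak to norm continuous map is norm to weak
continuous. -/
theorem tendsto_toWeakSpace_of_tendsto_image {C : Set E}
    (hC : IsCompact (toWeakSpace ℝ E '' C)) {L : E → ℋ} (hLinj : Function.Injective L)
    (hL : ContinuousOn (fun a : WeakSpace ℝ E => L ((toWeakSpace ℝ E).symm a))
      (toWeakSpace ℝ E '' C)) {a : ℕ → E} {b : E} (ha : ∀ k, a k ∈ C) (hb : b ∈ C)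
    (hlim : Tendsto (fun k => L (a k)) atTop (𝓝 (L b))) :
    Tendsto (fun k => toWeakSpace ℝ E (a k)) atTop (𝓝 (toWeakSpace ℝ E b)) := by
  have : CompactSpace (toWeakSpace ℝ E '' C) := isCompact_iff_compactSpace.1 hC
  rw [continuousOn_iff_continuous_domRestrict] at hL
  have hemb := hL.isClosedEmbedding (by
    rintro ⟨_, x, hx, rfl⟩ ⟨_, y, hy, rfl⟩ hxy
    have : x = y := hLinj (by simpa [Set.domRestrict_apply] using hxy)
    subst this
    rfl)
  let a' : ℕ → toWeakSpace ℝ E '' C := fun k => ⟨toWeakSpace ℝ E (a k), a k, ha k, rfl⟩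
  have h1 : Tendsto a' atTop (𝓝 ⟨toWeakSpace ℝ E b, b, hb, rfl⟩) := by
    rw [hemb.isInducing.tendsto_nhds_iff]
    simpa [Function.comp_def, a', Set.domRestrict_apply] using hlim
  exact (continuous_subtype_val.tendsto _).comp h1

theorem QuasiconcaveOn.convex_maximizers {C : Set E} {u : E → ℝ} (hu : QuasiconcaveOn ℝ C u) :
    Convex ℝ (maximizers C u) := by
  intro x hx y hy a b ha hb hab
  have h := fun c hc => hu (u c) ⟨hx.1, hx.2 c hc⟩ ⟨hy.1, hy.2 c hc⟩ ha hb hab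
  exact ⟨(h x hx.1).1, fun c hc => (h c hc).2⟩

theorem maximizers_nonempty {C : Set E} (hCne : C.Nonempty)
    (hC : IsCompact (toWeakSpace ℝ E '' C)) {u : E → ℝ}
    (hu : ContinuousOn (fun a : WeakSpace ℝ E => u ((toWeakSpace ℝ E).symm a))
      (toWeakSpace ℝ E '' C)) : (maximizers C u).Nonempty := by
  obtain ⟨_, ⟨a, ha, rfl⟩, hmax⟩ := hC.exists_isMaxOn (hCne.image _) hu
  refine ⟨a, ha, fun b hb => ?_⟩
  simpa using hmax ⟨b, hb, rfl⟩

variable {C : Set E} (hC : IsCompact (toWeakSpace ℝ E '' C)) {u : E → E → ℝ}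
  (hu : ContinuousOn (fun p : WeakSpace ℝ E × WeakSpace ℝ E =>
      u ((toWeakSpace ℝ E).symm p.1) ((toWeakSpace ℝ E).symm p.2))
    ((toWeakSpace ℝ E '' C) ×ˢ (Set.univ : Set (WeakSpace ℝ E))))
  {L : E → ℋ} (hLinj : Function.Injective L)
  (hL : ContinuousOn (fun a : WeakSpace ℝ E => L ((toWeakSpace ℝ E).symm a))
    (toWeakSpace ℝ E '' C))

include hC hu hLinj hL

theorem mem_image_maximizers_of_tendsto {e : ℕ → E} {e₀ : E}
    (he : Tendsto (fun k => toWeakSpace ℝ E (e k)) atTop (𝓝 (toWeakSpace ℝ E e₀)))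
    {y : ℕ → ℋ} {y₀ : ℋ} (hy : ∀ k, y k ∈ L '' maximizers C fun a => u a (e k))
    (hlim : Tendsto y atTop (𝓝 y₀)) : y₀ ∈ L '' maximizers C fun a => u a e₀ := by
  choose a ha hay using hy
  obtain ⟨b, hb, rfl⟩ : y₀ ∈ L '' C := (isCompact_image_of_weak hC hL).isClosed.mem_of_tendsto hlim
    (Eventually.of_forall fun k => ⟨a k, (ha k).1, hay k⟩)
  have hab := tendsto_toWeakSpace_of_tendsto_image hC hLinj hL (fun k => (ha k).1) hb
    (by simpa only [hay] using hlim)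
  have hcont : ∀ {c : ℕ → E} {c₀ : E}, (∀ k, c k ∈ C) → c₀ ∈ C →
      Tendsto (fun k => toWeakSpace ℝ E (c k)) atTop (𝓝 (toWeakSpace ℝ E c₀)) →
      Tendsto (fun k => u (c k) (e k)) atTop (𝓝 (u c₀ e₀)) := by
    intro c c₀ hc hc₀ hcc
    have h1 := hu (toWeakSpace ℝ E c₀, toWeakSpace ℝ E e₀) ⟨⟨c₀, hc₀, rfl⟩, Set.mem_univ _⟩
    have h2 := h1.tendsto.comp (tendsto_nhdsWithin_iff.2
      ⟨hcc.prodMk_nhds he, Eventually.of_forall fun k => ⟨⟨c k, hc k, rfl⟩, Set.mem_univ _⟩⟩)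
    simpa [Function.comp_def] using h2
  refine ⟨b, ⟨hb, fun c hc => ?_⟩, rfl⟩
  exact le_of_tendsto_of_tendsto' (hcont (fun _ => hc) hc tendsto_const_nhds)
    (hcont (fun k => (ha k).1) hb hab) fun k => (ha k).2 c hc

theorem isClosed_image_maximizers (e₀ : E) : IsClosed (L '' maximizers C fun a => u a e₀) :=
  IsSeqClosed.isClosed fun _ _ hy hlim =>
    mem_image_maximizers_of_tendsto hC hu hLinj hL (e := fun _ => e₀) tendsto_const_nhds hy hlim

theorem mem_image_maximizers_of_mem_closedConvexHull [NormedSpace ℝ ℋ] {e : ℕ → E} {e₀ : E}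
    (he : Tendsto (fun k => toWeakSpace ℝ E (e k)) atTop (𝓝 (toWeakSpace ℝ E e₀)))
    (hconv : Convex ℝ (L '' maximizers C fun a => u a e₀))
    {y : ℕ → ℋ} {y₀ : ℋ} (hy : ∀ k, y k ∈ L '' maximizers C fun a => u a (e k))
    (hy₀ : ∀ n, y₀ ∈ closedConvexHull ℝ (y '' Set.Ici n)) :
    y₀ ∈ L '' maximizers C fun a => u a e₀ := by
  set R := L '' maximizers C fun a => u a e₀ with hR
  rw [hR, ← (isClosed_image_maximizers hC hu hLinj hL e₀).closure_eq,
    Metric.closure_eq_iInter_cthickening, ← hR]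
  refine Set.mem_iInter₂.2 fun δ hδ => ?_
  have hev : ∀ᶠ k in atTop, y k ∈ Metric.thickening δ R := by
    by_contra hcon
    obtain ⟨ψ, hψ, hψR⟩ := extraction_of_frequently_atTop (not_eventually.1 hcon)
    obtain ⟨z, -, χ, hχ, hlim⟩ := (isCompact_image_of_weak hC hL).isSeqCompact
      (x := fun k => y (ψ k)) fun k => Set.image_mono (fun a ha => ha.1) (hy (ψ k))
    have hz : z ∈ R := mem_image_maximizers_of_tendsto hC hu hLinj hL
      (he.comp (hψ.comp hχ).tendsto_atTop) (fun k => hy (ψ (χ k))) hlim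
    obtain ⟨k, hk⟩ := (hlim.eventually (Metric.ball_mem_nhds z hδ)).exists
    exact hψR (χ k) (Metric.mem_thickening_iff.2 ⟨z, hz, hk⟩)
  obtain ⟨n, hn⟩ := eventually_atTop.1 hev
  refine closedConvexHull_min ?_ (hconv.cthickening δ) Metric.isClosed_cthickening (hy₀ n)
  rintro _ ⟨k, hk, rfl⟩
  exact Metric.thickening_subset_cthickening _ _ (hn k hk)

end WeaklyCompact

/-- The square integrable functions with values in the images of `S t` under `(φ t)⁻¹ • J`. -/
def rescaledSelections {T E ℋ : Type*} [MeasurableSpace T] (μ : Measure T) [NormedAddCommGroup E]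
    [NormedSpace ℝ E] [NormedAddCommGroup ℋ] [NormedSpace ℝ ℋ] (S : T → Set E) (φ : T → ℝ)
    (J : E →L[ℝ] ℋ) : Set (Lp ℋ 2 μ) :=
  {z | ∀ᵐ t ∂μ, z t ∈ (fun a => (φ t)⁻¹ • J a) '' S t}

theorem measurable_unscale {T F ℋ : Type*} [MeasurableSpace T] {μ : Measure T} [MeasurableSpace F]
    [NormedAddCommGroup ℋ] [NormedSpace ℝ ℋ] [MeasurableSpace ℋ] [BorelSpace ℋ]
    [SecondCountableTopology ℋ] {φ : T → ℝ} {R : ℋ → F} (hφm : Measurable φ) (hRm : Measurable R)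
    (z : Lp ℋ 2 μ) : Measurable fun t => R (φ t • z t) :=
  hRm.comp (hφm.smul (Lp.stronglyMeasurable z).measurable)

section RescaledSelections

variable {T E ℋ : Type*} [MeasurableSpace T] {μ : Measure T} [NormedAddCommGroup E]
  [NormedSpace ℝ E] [NormedAddCommGroup ℋ] [NormedSpace ℝ ℋ] {S : T → Set E} {φ : T → ℝ}
  {J : E →L[ℝ] ℋ} {R : ℋ → E}

theorem ae_mem_of_mem_rescaledSelections (hφ : ∀ t, 0 < φ t) (hR : ∀ a, R (J a) = a)
    {z : Lp ℋ 2 μ} (hz : z ∈ rescaledSelections μ S φ J) :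
    ∀ᵐ t ∂μ, R (φ t • z t) ∈ S t ∧ J (R (φ t • z t)) = φ t • z t := by
  filter_upwards [hz] with t ⟨a, ha, hat⟩
  rw [← hat, smul_inv_smul₀ (hφ t).ne', hR]
  exact ⟨ha, rfl⟩

theorem convex_image_smul {C : Set E} (hC : Convex ℝ C) (c : ℝ) :
    Convex ℝ ((fun a => c • J a) '' C) :=
  hC.is_linear_image ⟨fun a b => by simp, fun r a => by simp [smul_comm c r]⟩

theorem convex_rescaledSelections (hS : ∀ t, Convex ℝ (S t)) :
    Convex ℝ (rescaledSelections μ S φ J) :=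
  convex_setOf_ae_mem (Eventually.of_forall fun t => convex_image_smul (hS t) _)

theorem continuousOn_smul_of_subset_closedBall
    (hJ : ∀ r, ContinuousOn (fun a : WeakSpace ℝ E => J ((toWeakSpace ℝ E).symm a))
      (toWeakSpace ℝ E '' Metric.closedBall 0 r)) {C : Set E} {r : ℝ} (hC : ∀ a ∈ C, ‖a‖ ≤ r)
    (c : ℝ) : ContinuousOn (fun a : WeakSpace ℝ E => c • J ((toWeakSpace ℝ E).symm a))
      (toWeakSpace ℝ E '' C) :=
  (((hJ r).mono (Set.image_mono fun a ha => mem_closedBall_zero_iff.2 (hC a ha)))).const_smul c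

theorem isClosed_rescaledSelections
    (hJ : ∀ r, ContinuousOn (fun a : WeakSpace ℝ E => J ((toWeakSpace ℝ E).symm a))
      (toWeakSpace ℝ E '' Metric.closedBall 0 r))
    (hS : ∀ t, IsCompact (toWeakSpace ℝ E '' S t)) (hSφ : ∀ᵐ t ∂μ, ∀ a ∈ S t, ‖a‖ ≤ φ t) :
    IsClosed (rescaledSelections μ S φ J) := by
  refine isClosed_setOf_ae_mem ?_
  filter_upwards [hSφ] with t ht
  exact (isCompact_image_of_weak (hS t) (continuousOn_smul_of_subset_closedBall hJ ht _)).isClosed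

theorem norm_inv_smul_le {a : E} {c : ℝ} (hc : 0 < c) (ha : ‖a‖ ≤ c) : ‖c⁻¹ • J a‖ ≤ ‖J‖ := by
  rw [norm_smul, norm_inv, Real.norm_of_nonneg hc.le, inv_mul_le_iff₀ hc, mul_comm]
  exact J.le_of_opNorm_le_of_le le_rfl ha

theorem isBounded_rescaledSelections [IsFiniteMeasure μ] (hφ : ∀ t, 0 < φ t)
    (hSφ : ∀ᵐ t ∂μ, ∀ a ∈ S t, ‖a‖ ≤ φ t) : Bornology.IsBounded (rescaledSelections μ S φ J) := by
  rw [isBounded_iff_forall_norm_le]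
  refine ⟨_, fun z hz => Lp.norm_le_of_ae_bound (C := ‖J‖) (norm_nonneg _) ?_⟩
  filter_upwards [hz, hSφ] with t ⟨a, ha, hat⟩ ht
  rw [← hat]
  exact norm_inv_smul_le (hφ t) (ht a ha)

theorem norm_unscale_le (hφ : ∀ t, 0 < φ t) (hR : ∀ a, R (J a) = a)
    (hSφ : ∀ᵐ t ∂μ, ∀ a ∈ S t, ‖a‖ ≤ φ t) {z : Lp ℋ 2 μ} (hz : z ∈ rescaledSelections μ S φ J) :
    ∀ᵐ t ∂μ, ‖R (φ t • z t)‖ ≤ φ t := by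
  filter_upwards [ae_mem_of_mem_rescaledSelections hφ hR hz, hSφ] with t ht hSt
  exact hSt _ ht.1

variable [MeasurableSpace E] [BorelSpace E] [SecondCountableTopology E]

theorem exists_Lp_ae_eq_smul [IsFiniteMeasure μ] (hφm : Measurable φ) (hφ : ∀ t, 0 < φ t)
    (hSφ : ∀ᵐ t ∂μ, ∀ a ∈ S t, ‖a‖ ≤ φ t) {f : T → E} (hf : Measurable f)
    (hfS : ∀ᵐ t ∂μ, f t ∈ S t) : ∃ z : Lp ℋ 2 μ, ∀ᵐ t ∂μ, z t = (φ t)⁻¹ • J (f t) := by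
  have hmem : MemLp (fun t => (φ t)⁻¹ • J (f t)) 2 μ := by
    refine MemLp.of_bound ?_ ‖J‖ ?_
    · exact (hφm.inv.stronglyMeasurable.smul
        (J.continuous.comp_stronglyMeasurable hf.stronglyMeasurable)).aestronglyMeasurable
    · filter_upwards [hSφ, hfS] with t ht hft
      exact norm_inv_smul_le (hφ t) (ht _ hft)
  exact ⟨hmem.toLp, hmem.coeFn_toLp⟩

variable [MeasurableSpace ℋ] [BorelSpace ℋ] [SecondCountableTopology ℋ]

theorem integrable_unscale (hφm : Measurable φ) (hφ : ∀ t, 0 < φ t) (hφi : Integrable φ μ)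
    (hRm : Measurable R) (hR : ∀ a, R (J a) = a) (hSφ : ∀ᵐ t ∂μ, ∀ a ∈ S t, ‖a‖ ≤ φ t)
    {z : Lp ℋ 2 μ} (hz : z ∈ rescaledSelections μ S φ J) :
    Integrable (fun t => R (φ t • z t)) μ :=
  hφi.mono' (measurable_unscale hφm hRm z).aestronglyMeasurable (norm_unscale_le hφ hR hSφ hz)

theorem integrable_smul_unscale (hφm : Measurable φ) (hφ : ∀ t, 0 < φ t) (hφi : Integrable φ μ)
    (hRm : Measurable R) (hR : ∀ a, R (J a) = a) (hSφ : ∀ᵐ t ∂μ, ∀ a ∈ S t, ‖a‖ ≤ φ t)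
    {w : T → ℝ} (hwm : Measurable w) (hw : ∀ t, w t ∈ Set.Icc (0 : ℝ) 1)
    {z : Lp ℋ 2 μ} (hz : z ∈ rescaledSelections μ S φ J) :
    Integrable (fun t => w t • R (φ t • z t)) μ :=
  (integrable_unscale hφm hφ hφi hRm hR hSφ hz).bdd_smul 1 hwm.aestronglyMeasurable
    (Eventually.of_forall fun t => by
      rw [Real.norm_of_nonneg (hw t).1]
      exact (hw t).2)

/-- Weak aggregates are norm-closed under taking sublevel sets. -/
theorem isClosed_setOf_integral_le (hφm : Measurable φ) (hφ : ∀ t, 0 < φ t) (hφi : Integrable φ μ)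
    (hJinj : Function.Injective J)
    (hJ : ∀ r, ContinuousOn (fun a : WeakSpace ℝ E => J ((toWeakSpace ℝ E).symm a))
      (toWeakSpace ℝ E '' Metric.closedBall 0 r))
    (hRm : Measurable R) (hR : ∀ a, R (J a) = a)
    (hS : ∀ t, IsCompact (toWeakSpace ℝ E '' S t)) (hSφ : ∀ᵐ t ∂μ, ∀ a ∈ S t, ‖a‖ ≤ φ t)
    {w : T → ℝ} (hwm : Measurable w) (hw : ∀ t, w t ∈ Set.Icc (0 : ℝ) 1) (l : E →L[ℝ] ℝ) (c : ℝ) :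
    IsClosed {z | z ∈ rescaledSelections μ S φ J ∧ ∫ t, l (w t • R (φ t • z t)) ∂μ ≤ c} := by
  refine IsSeqClosed.isClosed fun x a hx hlim => ?_
  have ha : a ∈ rescaledSelections μ S φ J :=
    (isClosed_rescaledSelections hJ hS hSφ).mem_of_tendsto hlim
      (Eventually.of_forall fun k => (hx k).1)
  refine ⟨ha, ?_⟩
  obtain ⟨ψ, -, hψ⟩ := Lp.exists_subseq_tendsto_ae hlim
  have hdct : Tendsto (fun k => ∫ t, l (w t • R (φ t • x (ψ k) t)) ∂μ) atTop
      (𝓝 (∫ t, l (w t • R (φ t • a t)) ∂μ)) := by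
    refine tendsto_integral_of_dominated_convergence (fun t => ‖l‖ * φ t) (fun k => ?_)
      (hφi.const_mul _) (fun k => ?_) ?_
    · exact (l.measurable.comp
        (hwm.smul (measurable_unscale hφm hRm _))).aestronglyMeasurable
    · filter_upwards [norm_unscale_le hφ hR hSφ (hx (ψ k)).1] with t ht
      refine l.le_of_opNorm_le_of_le le_rfl ?_
      rw [norm_smul, Real.norm_of_nonneg (hw t).1]
      exact (mul_le_of_le_one_left (norm_nonneg _) (hw t).2).trans ht
    · filter_upwards [hψ, hSφ, ae_mem_of_mem_rescaledSelections hφ hR ha,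
        ae_all_iff.2 fun k => ae_mem_of_mem_rescaledSelections hφ hR (hx k).1] with t ht hSt hat hxt
      have h1 := tendsto_toWeakSpace_of_tendsto_image (hS t) hJinj (by
        simpa using continuousOn_smul_of_subset_closedBall hJ hSt 1) (fun k => (hxt (ψ k)).1) hat.1
        (by
          rw [hat.2]
          simp only [(hxt _).2]
          exact ht.const_smul (φ t))
      have h2 := ((WeakBilin.eval_continuous (topDualPairing ℝ E).flip l).tendsto _).comp h1
      have h3 : Tendsto (fun k => l (R (φ t • x (ψ k) t))) atTop (𝓝 (l (R (φ t • a t)))) := h2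
      simpa only [map_smul] using h3.const_smul (w t)
  exact le_of_tendsto' hdct fun k => (hx _).2

theorem convex_setOf_integral_le (hφm : Measurable φ) (hφ : ∀ t, 0 < φ t) (hφi : Integrable φ μ)
    (hJinj : Function.Injective J)
    (hRm : Measurable R) (hR : ∀ a, R (J a) = a)
    (hS : ∀ t, Convex ℝ (S t)) (hSφ : ∀ᵐ t ∂μ, ∀ a ∈ S t, ‖a‖ ≤ φ t)
    {w : T → ℝ} (hwm : Measurable w) (hw : ∀ t, w t ∈ Set.Icc (0 : ℝ) 1) (l : E →L[ℝ] ℝ) (c : ℝ) :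
    Convex ℝ {z | z ∈ rescaledSelections μ S φ J ∧ ∫ t, l (w t • R (φ t • z t)) ∂μ ≤ c} := by
  intro x hx y hy a b ha hb hab
  have hxy := convex_rescaledSelections hS hx.1 hy.1 ha hb hab
  refine ⟨hxy, ?_⟩
  have hinteg : ∀ {z}, z ∈ rescaledSelections μ S φ J →
      Integrable (fun t => l (w t • R (φ t • z t))) μ := fun hz =>
    l.integrable_comp (integrable_smul_unscale hφm hφ hφi hRm hR hSφ hwm hw hz)
  have heq : ∫ t, l (w t • R (φ t • (a • x + b • y : Lp ℋ 2 μ) t)) ∂μ =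
      a * ∫ t, l (w t • R (φ t • x t)) ∂μ + b * ∫ t, l (w t • R (φ t • y t)) ∂μ := by
    rw [← integral_const_mul, ← integral_const_mul,
      ← integral_add ((hinteg hx.1).const_mul a) ((hinteg hy.1).const_mul b)]
    refine integral_congr_ae ?_
    filter_upwards [ae_mem_of_mem_rescaledSelections hφ hR hx.1,
      ae_mem_of_mem_rescaledSelections hφ hR hy.1, ae_mem_of_mem_rescaledSelections hφ hR hxy,
      Lp.coeFn_add (a • x) (b • y), Lp.coeFn_smul a x, Lp.coeFn_smul b y]
      with t hxt hyt hxyt h1 h2 h3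
    have : R (φ t • (a • x + b • y : Lp ℋ 2 μ) t) = a • R (φ t • x t) + b • R (φ t • y t) := by
      apply hJinj
      rw [hxyt.2, map_add, map_smul, map_smul, hxt.2, hyt.2, h1, Pi.add_apply, h2, h3,
        Pi.smul_apply, Pi.smul_apply, smul_add, smul_comm _ a, smul_comm _ b]
    rw [this]
    simp only [smul_add, map_add, map_smul, smul_eq_mul]
    ring
  rw [heq]
  calc _ ≤ a * c + b * c := by
        gcongr
        · exact hx.2
        · exact hy.2
    _ = c := by rw [← add_mul, hab, one_mul]

/-- Aggregates depend continuously on the profile, for the weak topologies. -/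
theorem tendsto_toWeakSpace_integral [CompleteSpace E] (hφm : Measurable φ) (hφ : ∀ t, 0 < φ t)
    (hφi : Integrable φ μ) (hJinj : Function.Injective J)
    (hJ : ∀ r, ContinuousOn (fun a : WeakSpace ℝ E => J ((toWeakSpace ℝ E).symm a))
      (toWeakSpace ℝ E '' Metric.closedBall 0 r))
    (hRm : Measurable R) (hR : ∀ a, R (J a) = a) (hSconv : ∀ t, Convex ℝ (S t))
    (hS : ∀ t, IsCompact (toWeakSpace ℝ E '' S t)) (hSφ : ∀ᵐ t ∂μ, ∀ a ∈ S t, ‖a‖ ≤ φ t)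
    {w : T → ℝ} (hwm : Measurable w) (hw : ∀ t, w t ∈ Set.Icc (0 : ℝ) 1)
    {x : ℕ → Lp ℋ 2 μ} {a : Lp ℋ 2 μ} (hx : ∀ k, x k ∈ rescaledSelections μ S φ J)
    (ha : a ∈ rescaledSelections μ S φ J)
    (hlim : ∀ l : Lp ℋ 2 μ →L[ℝ] ℝ, Tendsto (fun k => l (x k)) atTop (𝓝 (l a))) :
    Tendsto (fun k => toWeakSpace ℝ E (∫ t, w t • R (φ t • x k t) ∂μ)) atTop
      (𝓝 (toWeakSpace ℝ E (∫ t, w t • R (φ t • a t) ∂μ))) := by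
  have hle : ∀ (l : E →L[ℝ] ℝ) (c : ℝ), (∃ᶠ k in atTop, l (∫ t, w t • R (φ t • x k t) ∂μ) ≤ c) →
      l (∫ t, w t • R (φ t • a t) ∂μ) ≤ c := by
    intro l c hfreq
    have hinteg : ∀ {z}, z ∈ rescaledSelections μ S φ J → ∫ t, l (w t • R (φ t • z t)) ∂μ =
        l (∫ t, w t • R (φ t • z t) ∂μ) := fun hz =>
      l.integral_comp_comm (integrable_smul_unscale hφm hφ hφi hRm hR hSφ hwm hw hz)
    have := (convex_setOf_integral_le hφm hφ hφi hJinj hRm hR hSconv hSφ hwm hw l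
      c).mem_of_weakly_tendsto
      (isClosed_setOf_integral_le hφm hφ hφi hJinj hJ hRm hR hS hSφ hwm hw l c)
      (hfreq.mono fun k hk => ⟨hx k, (hinteg (hx k)).trans_le hk⟩) hlim
    exact (hinteg ha).symm.trans_le this.2
  refine (WeakBilin.tendsto_iff_forall_eval_tendsto _ (separatingDual_iff_injective.1
    inferInstance)).2 fun l => ?_
  change Tendsto (fun k => l _) atTop (𝓝 (l _))
  rw [tendsto_order]
  constructor
  · intro c hc
    by_contra hcon
    rw [not_eventually] at hcon
    exact absurd (hle l c (hcon.mono fun k hk => not_lt.1 hk)) (not_le.2 hc)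
  · intro c hc
    by_contra hcon
    rw [not_eventually] at hcon
    have hneg : -l (∫ t, w t • R (φ t • a t) ∂μ) ≤ -c :=
      hle (-l) (-c) (hcon.mono fun k hk => neg_le_neg (not_lt.1 hk))
    exact absurd (neg_le_neg_iff.1 hneg) (not_le.2 hc)

end RescaledSelections

section BestReplies

variable {E ℋ T : Type*} [NormedAddCommGroup E] [NormedSpace ℝ E] [NormedAddCommGroup ℋ]
  [NormedSpace ℝ ℋ] [MeasurableSpace T] {μ : Measure T}

/-- The aggregate seen by the agents when the rescaled profile `h` is played. -/
noncomputable def aggregate (μ : Measure T) (W : T → T → ℝ) (φ : T → ℝ) (R : ℋ → E)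
    (h : Lp ℋ 2 μ) (t : T) : E :=
  ∫ s, W t s • R (φ s • h s) ∂μ

/-- The rescaled best replies to the aggregates `e`. -/
def bestReplies (μ : Measure T) (S : T → Set E) (U : T → E → E → ℝ) (φ : T → ℝ) (J : E →L[ℝ] ℋ)
    (e : T → E) : Set (Lp ℋ 2 μ) :=
  rescaledSelections μ (fun t => maximizers (S t) fun a => U t a (e t)) φ J

theorem stronglyMeasurable_aggregate [IsFiniteMeasure μ] [MeasurableSpace E] [BorelSpace E]
    [SecondCountableTopology E] [MeasurableSpace ℋ] [BorelSpace ℋ] [SecondCountableTopology ℋ]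
    {W : T → T → ℝ} (hW : Measurable (Function.uncurry W)) {φ : T → ℝ} (hφm : Measurable φ)
    {R : ℋ → E} (hRm : Measurable R) (h : Lp ℋ 2 μ) :
    StronglyMeasurable (aggregate μ W φ R h) :=
  StronglyMeasurable.integral_prod_right
    (hW.smul ((measurable_unscale hφm hRm h).comp measurable_snd)).stronglyMeasurable

variable {S : T → Set E} {U : T → E → E → ℝ} {φ : T → ℝ} {J : E →L[ℝ] ℋ}

theorem bestReplies_nonempty [IsFiniteMeasure μ] [μ.IsComplete] [CompleteSpace E]
    [SecondCountableTopology E] [MeasurableSpace E] [BorelSpace E]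
    (hSne : ∀ t, (S t).Nonempty) (hS : ∀ t, IsCompact (toWeakSpace ℝ E '' S t))
    (hSgraph : MeasurableSet {p : T × E | p.2 ∈ S p.1})
    (hUc : ∀ t, ContinuousOn
      (fun p : WeakSpace ℝ E × WeakSpace ℝ E =>
        U t ((toWeakSpace ℝ E).symm p.1) ((toWeakSpace ℝ E).symm p.2))
      ((toWeakSpace ℝ E '' S t) ×ˢ (Set.univ : Set (WeakSpace ℝ E))))
    (hUm : ∀ e : E, Measurable fun p : {q : T × E // q.2 ∈ S q.1} => U p.1.1 p.1.2 e)
    (hφm : Measurable φ) (hφ : ∀ t, 0 < φ t) (hSφ : ∀ᵐ t ∂μ, ∀ a ∈ S t, ‖a‖ ≤ φ t)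
    {e : T → E} (he : StronglyMeasurable e) : (bestReplies μ S U φ J e).Nonempty := by
  have hne : ∀ t, (maximizers (S t) fun a => U t a (e t)).Nonempty := fun t =>
    maximizers_nonempty (hSne t) (hS t) ((hUc t).comp
      (f := fun a : WeakSpace ℝ E => (a, toWeakSpace ℝ E (e t))) (by fun_prop)
      fun a ha => ⟨ha, Set.mem_univ _⟩)
  have hVc : ∀ p : {q : T × E // q.2 ∈ S q.1}, Continuous fun e => U p.1.1 p.1.2 e := fun p =>
    (hUc p.1.1).comp_continuous (f := fun e : E => (toWeakSpace ℝ E p.1.2, toWeakSpace ℝ E e))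
      (continuous_const.prodMk (toWeakSpaceCLM ℝ E).continuous)
      fun e => ⟨⟨_, p.2, rfl⟩, Set.mem_univ _⟩
  obtain ⟨f, hf, hfm⟩ := exists_measurable_maximizer μ hSgraph (u := fun t a => U t a (e t))
    (measurable_apply_of_forall_tendsto (measurable_fst.comp measurable_subtype_coe) hUm hVc he) hne
  obtain ⟨z, hz⟩ := exists_Lp_ae_eq_smul (J := J) hφm hφ hSφ hf
    (Eventually.of_forall fun t => (hfm t).1)
  refine ⟨z, ?_⟩
  filter_upwards [hz] with t ht
  exact ⟨f t, hfm t, ht.symm⟩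

theorem convex_bestReplies (hU : ∀ t e, QuasiconcaveOn ℝ (S t) fun a => U t a e) (e : T → E) :
    Convex ℝ (bestReplies μ S U φ J e) :=
  convex_rescaledSelections fun t => (hU t (e t)).convex_maximizers

theorem bestReplies_subset (e : T → E) :
    bestReplies μ S U φ J e ⊆ rescaledSelections μ S φ J := by
  intro z hz
  have hz' : ∀ᵐ t ∂μ, z t ∈ (fun a => (φ t)⁻¹ • J a) '' maximizers (S t) fun a => U t a (e t) := hz
  exact hz'.mono fun t ht => Set.image_mono (fun a ha => ha.1) ht

/-- Best replies have a closed graph: aggregates may vary weakly pointwise, replies weakly. -/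
theorem mem_bestReplies_of_tendsto [CompleteSpace ℋ] (hφ : ∀ t, 0 < φ t)
    (hJinj : Function.Injective J)
    (hJ : ∀ r, ContinuousOn (fun a : WeakSpace ℝ E => J ((toWeakSpace ℝ E).symm a))
      (toWeakSpace ℝ E '' Metric.closedBall 0 r))
    (hS : ∀ t, IsCompact (toWeakSpace ℝ E '' S t)) (hSφ : ∀ᵐ t ∂μ, ∀ a ∈ S t, ‖a‖ ≤ φ t)
    (hUc : ∀ t, ContinuousOn
      (fun p : WeakSpace ℝ E × WeakSpace ℝ E =>
        U t ((toWeakSpace ℝ E).symm p.1) ((toWeakSpace ℝ E).symm p.2))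
      ((toWeakSpace ℝ E '' S t) ×ˢ (Set.univ : Set (WeakSpace ℝ E))))
    (hU : ∀ t e, QuasiconcaveOn ℝ (S t) fun a => U t a e)
    {e : ℕ → T → E} {e₀ : T → E}
    (he : ∀ t, Tendsto (fun k => toWeakSpace ℝ E (e k t)) atTop (𝓝 (toWeakSpace ℝ E (e₀ t))))
    {y : ℕ → Lp ℋ 2 μ} {b : Lp ℋ 2 μ} (hy : ∀ k, y k ∈ bestReplies μ S U φ J (e k))
    (hlim : ∀ l : Lp ℋ 2 μ →L[ℝ] ℝ, Tendsto (fun k => l (y k)) atTop (𝓝 (l b))) :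
    b ∈ bestReplies μ S U φ J e₀ := by
  have hb : ∀ n, ∀ᵐ t ∂μ, b t ∈ closedConvexHull ℝ ((fun k => y k t) '' Set.Ici n) := by
    intro n
    let D : T → Set ℋ := fun t => closedConvexHull ℝ ((fun k => y k t) '' Set.Ici n)
    have hconv : Convex ℝ {z : Lp ℋ 2 μ | ∀ᵐ t ∂μ, z t ∈ D t} :=
      convex_setOf_ae_mem (Eventually.of_forall fun t => convex_closedConvexHull)
    have hclosed : IsClosed {z : Lp ℋ 2 μ | ∀ᵐ t ∂μ, z t ∈ D t} :=
      isClosed_setOf_ae_mem (Eventually.of_forall fun t => isClosed_closedConvexHull)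
    have hmem : ∀ k, n ≤ k → y k ∈ {z : Lp ℋ 2 μ | ∀ᵐ t ∂μ, z t ∈ D t} := by
      intro k hk
      have hk' : ∀ᵐ t ∂μ, y k t ∈ D t := Eventually.of_forall fun t =>
        subset_closedConvexHull (Set.mem_image_of_mem (fun k => y k t) (Set.mem_Ici.2 hk))
      exact hk'
    exact hconv.mem_of_weakly_tendsto hclosed ((eventually_ge_atTop n).mono hmem).frequently hlim
  filter_upwards [ae_all_iff.2 hb, ae_all_iff.2 hy, hSφ] with t hbt hyt ht
  refine mem_image_maximizers_of_mem_closedConvexHull (hS t) (hUc t)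
    (fun a a' haa' => hJinj (smul_right_injective ℋ (inv_ne_zero (hφ t).ne') haa'))
    (continuousOn_smul_of_subset_closedBall hJ ht _) (he t)
    (convex_image_smul (hU t _).convex_maximizers _) hyt hbt

end BestReplies

/-- A rescaled profile which is a best reply to itself. -/
theorem exists_mem_bestReplies_aggregate {E ℋ T : Type*} [NormedAddCommGroup E] [NormedSpace ℝ E]
    [CompleteSpace E] [SecondCountableTopology E] [MeasurableSpace E] [BorelSpace E]
    [NormedAddCommGroup ℋ] [InnerProductSpace ℝ ℋ] [CompleteSpace ℋ] [SecondCountableTopology ℋ]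
    [MeasurableSpace ℋ] [BorelSpace ℋ] [MeasurableSpace T] {μ : Measure T} [IsFiniteMeasure μ]
    [μ.IsComplete] [IsSeparable μ] {W : T → T → ℝ} (hWm : Measurable (Function.uncurry W))
    (hW : ∀ t s, W t s ∈ Set.Icc (0 : ℝ) 1) {S : T → Set E} (hSne : ∀ t, (S t).Nonempty)
    (hSconv : ∀ t, Convex ℝ (S t)) (hS : ∀ t, IsCompact (toWeakSpace ℝ E '' S t))
    (hSgraph : MeasurableSet {p : T × E | p.2 ∈ S p.1}) {U : T → E → E → ℝ}
    (hUc : ∀ t, ContinuousOn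
      (fun p : WeakSpace ℝ E × WeakSpace ℝ E =>
        U t ((toWeakSpace ℝ E).symm p.1) ((toWeakSpace ℝ E).symm p.2))
      ((toWeakSpace ℝ E '' S t) ×ˢ (Set.univ : Set (WeakSpace ℝ E))))
    (hU : ∀ t e, QuasiconcaveOn ℝ (S t) fun a => U t a e)
    (hUm : ∀ e : E, Measurable fun p : {q : T × E // q.2 ∈ S q.1} => U p.1.1 p.1.2 e)
    {φ : T → ℝ} (hφm : Measurable φ) (hφ : ∀ t, 0 < φ t) (hφi : Integrable φ μ)
    (hSφ : ∀ᵐ t ∂μ, ∀ a ∈ S t, ‖a‖ ≤ φ t) {J : E →L[ℝ] ℋ} (hJinj : Function.Injective J)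
    (hJ : ∀ r, ContinuousOn (fun a : WeakSpace ℝ E => J ((toWeakSpace ℝ E).symm a))
      (toWeakSpace ℝ E '' Metric.closedBall 0 r)) {R : ℋ → E} (hRm : Measurable R)
    (hR : ∀ a, R (J a) = a) :
    ∃ h ∈ rescaledSelections μ S φ J, h ∈ bestReplies μ S U φ J (aggregate μ W φ R h) := by
  have hne : ∀ {e : T → E}, StronglyMeasurable e → (bestReplies μ S U φ J e).Nonempty :=
    fun he => bestReplies_nonempty hSne hS hSgraph hUc hUm hφm hφ hSφ he
  have : Fact ((2 : ENNReal) ≠ ⊤) := ⟨ENNReal.ofNat_ne_top⟩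
  refine exists_mem_of_weakly_closed_graph (isBounded_rescaledSelections hφ hSφ)
    (isClosed_rescaledSelections hJ hS hSφ) (convex_rescaledSelections hSconv)
    ((hne (stronglyMeasurable_const (b := 0))).mono (bestReplies_subset _))
    (fun h _ => bestReplies_subset _)
    (fun h _ => hne (stronglyMeasurable_aggregate hWm hφm hRm h))
    (fun h _ => convex_bestReplies hU _) fun x y a b ha _ hx hy hxa hyb =>
      mem_bestReplies_of_tendsto hφ hJinj hJ hS hSφ hUc hU (fun t => ?_) hy hyb
  exact tendsto_toWeakSpace_integral hφm hφ hφi hJinj hJ hRm hR hSconv hS hSφ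
    hWm.of_uncurry_left (hW t) hx ha hxa

/-- **Existence of Nash equilibria in graphon games with a measure space of agents**
(Theorem 1 of the paper). Under assumptions (A1)–(A6) there exists a Bochner integrable
strategy profile `f` with `f t ∈ S t` a.e. such that, for a.e. agent `t`, `f t` maximizes
`a ↦ U t a (∫ W t s • f s dμ s)` over `S t`. -/
theorem graphon_game_existence
    {E : Type*} [NormedAddCommGroup E] [NormedSpace ℝ E] [CompleteSpace E]
    [TopologicalSpace.SeparableSpace E] [MeasurableSpace E] [BorelSpace E]
    {T : Type*} [MeasurableSpace T] (μ : Measure T) [IsFiniteMeasure μ]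
    -- the measure space is complete
    (hμcomplete : μ.IsComplete)
    -- (A1) `(T, Σ, μ)` is essentially countably generated
    (hA1 : ∃ c : Set (Set T), c.Countable ∧
      ‹MeasurableSpace T› = MeasurableSpace.generateFrom (c ∪ {s : Set T | μ s = 0}))
    -- the graphon
    (W : T → T → ℝ) (hWmeas : Measurable (Function.uncurry W))
    (hW01 : ∀ t s, W t s ∈ Set.Icc (0 : ℝ) 1)
    -- the strategy correspondence
    (S : T → Set E)
    -- (A2) `S t` is nonempty, convex and weakly compact for all `t`
    (hSne : ∀ t, (S t).Nonempty)
    (hSconv : ∀ t, Convex ℝ (S t))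
    (hScomp : ∀ t, IsCompact (toWeakSpace ℝ E '' S t))
    -- (A3) `S` is graph measurable and integrably bounded
    (hSgraph : MeasurableSet {p : T × E | p.2 ∈ S p.1})
    (hSbdd : ∃ φ : T → ℝ, Integrable φ μ ∧ ∀ᵐ t ∂μ, ∀ a ∈ S t, ‖a‖ ≤ φ t)
    -- the utility function
    (U : T → E → E → ℝ)
    -- (A4) `U t` is continuous on `S t × E` for the weak topologies
    (hA4 : ∀ t, ContinuousOn
      (fun p : WeakSpace ℝ E × WeakSpace ℝ E =>
        U t ((toWeakSpace ℝ E).symm p.1) ((toWeakSpace ℝ E).symm p.2))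
      ((toWeakSpace ℝ E '' S t) ×ˢ (Set.univ : Set (WeakSpace ℝ E))))
    -- (A5) `U t · e` is quasi-concave on `S t`
    (hA5 : ∀ t e, QuasiconcaveOn ℝ (S t) (fun a => U t a e))
    -- (A6) `U · · e` is `Σ ⊗ B(E)`-measurable on the graph of `S`
    (hA6 : ∀ e : E, Measurable (fun p : {q : T × E // q.2 ∈ S q.1} => U p.1.1 p.1.2 e)) :
    ∃ f : T → E, Integrable f μ ∧ (∀ᵐ t ∂μ, f t ∈ S t) ∧
      ∀ᵐ t ∂μ, ∀ a ∈ S t,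
        U t a (∫ s, W t s • f s ∂μ) ≤ U t (f t) (∫ s, W t s • f s ∂μ) := by
  have := hμcomplete
  have := UniformSpace.secondCountable_of_separable E
  have := IsSeparable.of_generateFrom_union_null μ hA1
  have := separableSpace_lp_two
  have := UniformSpace.secondCountable_of_separable (lp (fun _ : ℕ => ℝ) 2)
  let _ : MeasurableSpace (lp (fun _ : ℕ => ℝ) 2) := borel _
  have : BorelSpace (lp (fun _ : ℕ => ℝ) 2) := ⟨rfl⟩
  obtain ⟨φ, hφm, hφ, hφi, hSφ⟩ : ∃ φ : T → ℝ, Measurable φ ∧ (∀ t, 0 < φ t) ∧ Integrable φ μ ∧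
      ∀ᵐ t ∂μ, ∀ a ∈ S t, ‖a‖ ≤ φ t := by
    obtain ⟨φ, hφ, hSφ⟩ := hSbdd
    refine ⟨fun t => max (hφ.1.mk φ t) 1, hφ.1.measurable_mk.max measurable_const,
      fun t => lt_max_of_lt_right one_pos, (hφ.congr hφ.1.ae_eq_mk).sup (integrable_const 1), ?_⟩
    filter_upwards [hSφ, hφ.1.ae_eq_mk] with t ht heq a ha
    exact ((ht a ha).trans_eq heq).trans (le_max_left _ _)
  obtain ⟨J, hJinj, hJ⟩ := exists_injective_weak_norm_continuousOn E
  obtain ⟨R, hRm, hR⟩ := (J.continuous.measurableEmbedding hJinj).exists_measurable_extend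
    measurable_id fun _ => ⟨0⟩
  replace hR := congr_fun hR
  obtain ⟨h, hK, hh⟩ := exists_mem_bestReplies_aggregate hWmeas hW01 hSne hSconv hScomp hSgraph hA4
    hA5 hA6 hφm hφ hφi hSφ hJinj hJ hRm hR
  refine ⟨fun t => R (φ t • h t), integrable_unscale hφm hφ hφi hRm hR hSφ hK,
    (ae_mem_of_mem_rescaledSelections hφ hR hK).mono fun t ht => ht.1, ?_⟩
  exact (ae_mem_of_mem_rescaledSelections hφ hR hh).mono fun t ht => ht.1.2
end

section
/- Let (I, (A_{ij}), (S_i), (v_i)) be a network game such that (i) each S_i is a nonempty, convex, weakly compact subset of the separable Banach space E, and (ii) each v_i : S_i × E → ℝ is continuous (with S_i and E carrying the weak topology) and v_i(·,e) is quasi-concave for every e ∈ E. Then the game has a Nash equilibrium: there exists s ∈ Π_{i∈I} S_i such that for every i ∈ I, v_i(s_i, |I|⁻¹ Σ_{j∈I} A_{ij} s_j) = max_{a ∈ S_i} v_i(a, |I|⁻¹ Σ_{j∈I} A_{ij} s_j). -/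
open MeasureTheory Set Filter Topology

/-- For small `t`, the map `x ↦ x + t • g x` is a diffeomorphism which preserves `s`, so it preserves
integrals over `s`. -/
theorem exists_pos_forall_setIntegral_comp_add_smul_mul_det {F : Type*} [NormedAddCommGroup F]
    [NormedSpace ℝ F] [FiniteDimensional ℝ F] [MeasurableSpace F] [BorelSpace F]
    (μ : Measure F) [μ.IsAddHaarMeasure] {g : F → F} (hg : ContDiff ℝ 1 g)
    (hgs : HasCompactSupport g) {s : Set F} (hs : MeasurableSet s)
    (hsupp : Function.support g ⊆ s) :
    ∃ ε > 0, ∀ t ∈ Ioo (0 : ℝ) ε, ∀ φ : F → ℝ,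
      ∫ x in s, φ (x + t • g x) * (1 + t • fderiv ℝ g x).det ∂μ = ∫ x in s, φ x ∂μ := by
  obtain ⟨K, hK⟩ := hg.lipschitzWith_of_hasCompactSupport hgs one_ne_zero
  have hdet : ∀ᶠ A : F →L[ℝ] F in 𝓝 1, 0 < A.det := by
    have h1 : (0 : ℝ) < (1 : F →L[ℝ] F).det := by
      simp [ContinuousLinearMap.det]
    exact ContinuousLinearMap.continuous_det.continuousAt.eventually (lt_mem_nhds h1)
  obtain ⟨η, hη, hball⟩ := Metric.eventually_nhds_iff.1 hdet
  refine ⟨min 1 η / (K + 1), by positivity, fun t ht φ => ?_⟩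
  have hK0 : (0 : ℝ) ≤ K := K.2
  have ht1 : t * K < min 1 η := by
    have := (lt_div_iff₀ (by positivity)).1 ht.2
    nlinarith [ht.1]
  have hlip : LipschitzWith (Real.toNNReal t * K) (fun x => t • g x) :=
    LipschitzWith.of_dist_le_mul fun x y => by
      rw [dist_smul₀, NNReal.coe_mul, Real.coe_toNNReal _ ht.1.le, mul_assoc,
        Real.norm_of_nonneg ht.1.le]
      exact mul_le_mul_of_nonneg_left (hK.dist_le_mul x y) ht.1.le
  have hlt : Real.toNNReal t * K < 1 := by
    rw [← NNReal.coe_lt_coe, NNReal.coe_mul, Real.coe_toNNReal _ ht.1.le]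
    exact ht1.trans_le (min_le_left _ _)
  have hinj : Function.Injective fun x => x + t • g x := by
    intro x y hxy
    have h := hlip.dist_le_mul x y
    have h2 : dist (t • g x) (t • g y) = dist x y := by
      rw [dist_eq_norm, dist_eq_norm, ← norm_neg]
      congr 1
      have : x + t • g x = y + t • g y := hxy
      rw [neg_sub, sub_eq_sub_iff_add_eq_add, add_comm, ← this, add_comm]
    rw [h2] at h
    have h3 : ((Real.toNNReal t * K : NNReal) : ℝ) < 1 := by exact_mod_cast hlt
    by_contra hne
    nlinarith [dist_pos.2 hne]
  have hsurj : Function.Surjective fun x => x + t • g x := by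
    intro y
    have hc : ContractingWith (Real.toNNReal t * K) (fun x => y - t • g x) :=
      ⟨hlt, LipschitzWith.of_dist_le_mul fun a b => by
        rw [dist_sub_left]; exact hlip.dist_le_mul a b⟩
    refine ⟨hc.fixedPoint, ?_⟩
    have := hc.fixedPoint_isFixedPt
    exact (eq_sub_iff_add_eq.1 this.symm)
  have himg : (fun x => x + t • g x) '' s = s := by
    have hout : ∀ x ∉ s, x + t • g x = x := fun x hx => by
      have : g x = 0 := by
        by_contra h
        exact hx (hsupp h)
      simp [this]
    ext y
    constructor
    · rintro ⟨x, hx, rfl⟩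
      by_contra hy
      have h := hinj (hout _ hy)
      exact hy (h.symm ▸ hx)
    · intro hy
      obtain ⟨x, rfl⟩ := hsurj y
      refine ⟨x, ?_, rfl⟩
      by_contra hx
      simp only [hout x hx] at hy
      exact hx hy
  have hder : ∀ x ∈ s, HasFDerivWithinAt (fun x => x + t • g x) (1 + t • fderiv ℝ g x) s x :=
    fun x _ => ((hasFDerivAt_id x).add
      (((hg.differentiable one_ne_zero) x).hasFDerivAt.const_smul t)).hasFDerivWithinAt
  have hpos : ∀ x, 0 < (1 + t • fderiv ℝ g x).det := fun x => by
    apply hball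
    rw [dist_eq_norm, add_sub_cancel_left, norm_smul, Real.norm_of_nonneg ht.1.le]
    calc t * ‖fderiv ℝ g x‖ ≤ t * K :=
          mul_le_mul_of_nonneg_left (norm_fderiv_le_of_lipschitz ℝ hK) ht.1.le
      _ < η := ht1.trans_le (min_le_right _ _)
  have key := integral_image_eq_integral_abs_det_fderiv_smul μ hs hder hinj.injOn φ
  rw [himg] at key
  rw [key]
  refine integral_congr_ae (Eventually.of_forall fun x => ?_)
  simp only [abs_of_pos (hpos x), smul_eq_mul, mul_comm]

/-- Integrating a polynomial with continuous coefficients yields a polynomial. -/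
theorem exists_polynomial_eval_eq_setIntegral {X : Type*} [TopologicalSpace X] [T2Space X]
    [MeasurableSpace X] [OpensMeasurableSpace X] (μ : Measure X)
    [IsFiniteMeasureOnCompacts μ] {s : Set X} (hs : IsCompact s) (P : Polynomial C(X, ℝ)) :
    ∃ p : Polynomial ℝ, ∀ t : ℝ,
      p.eval t = ∫ x in s, (P.eval (ContinuousMap.const X t)) x ∂μ := by
  refine ⟨P.sum fun k a => Polynomial.monomial k (∫ x in s, a x ∂μ), fun t => ?_⟩
  simp only [Polynomial.eval_eq_sum (p := P), Polynomial.sum_def, Polynomial.eval_finsetSum,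
    Polynomial.eval_monomial, ContinuousMap.sum_apply, ContinuousMap.mul_apply,
    ContinuousMap.pow_apply, ContinuousMap.const_apply]
  rw [integral_finsetSum _ fun k _ => ContinuousOn.integrableOn_compact' hs hs.measurableSet
    (by fun_prop)]
  simp [integral_mul_const]

theorem exists_polynomial_eval_eq_setIntegral_pow_mul_det {ι : Type*} [Fintype ι]
    {g : (ι → ℝ) → (ι → ℝ)} (hg : ContDiff ℝ 1 g) {s : Set (ι → ℝ)} (hs : IsCompact s)
    (c : ℝ) (k : ℕ) :
    ∃ p : Polynomial ℝ, ∀ t : ℝ, p.eval t =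
      ∫ x in s, (1 - c * ∑ i, (x + t • g x) i ^ 2) ^ k * (1 + t • fderiv ℝ g x).det := by
  classical
  have hgc := hg.continuous
  have hfc := hg.continuous_fderiv one_ne_zero
  let G : ι → C(ι → ℝ, ℝ) := fun i => ⟨fun x => g x i, by fun_prop⟩
  let Q : ι → C(ι → ℝ, ℝ) := fun i => ⟨fun x => x i, by fun_prop⟩
  let D : Matrix ι ι C(ι → ℝ, ℝ) := Matrix.of fun i j =>
    ⟨fun x => fderiv ℝ g x (Pi.single j 1) i,
      (continuous_apply i).comp (hfc.clm_apply continuous_const)⟩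
  let M : Matrix ι ι (Polynomial C(ι → ℝ, ℝ)) :=
    1 + (Polynomial.X : Polynomial C(ι → ℝ, ℝ)) • D.map Polynomial.C
  obtain ⟨p, hp⟩ := exists_polynomial_eval_eq_setIntegral volume hs
    ((1 - Polynomial.C (ContinuousMap.const (ι → ℝ) c) *
      ∑ i, (Polynomial.C (Q i) + Polynomial.X * Polynomial.C (G i)) ^ 2) ^ k * M.det)
  refine ⟨p, fun t => ?_⟩
  rw [hp]
  congr 1 with x
  have hdet : (M.det.eval (ContinuousMap.const (ι → ℝ) t)) x = (1 + t • fderiv ℝ g x).det := by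
    let ψ : Polynomial C(ι → ℝ, ℝ) →+* ℝ :=
      (ContinuousMap.evalAlgHom ℝ ℝ x).toRingHom.comp
        (Polynomial.evalRingHom (ContinuousMap.const (ι → ℝ) t))
    have h1 : (M.det.eval (ContinuousMap.const (ι → ℝ) t)) x = ψ M.det := rfl
    rw [h1, RingHom.map_det, ContinuousLinearMap.det, ← LinearMap.det_toMatrix']
    congr 1
    ext i j
    simp [ψ, M, D, LinearMap.toMatrix'_apply, Matrix.one_apply, Pi.single_apply]
    split_ifs <;> simp [mul_comm t]
  simp only [Polynomial.eval_mul, ContinuousMap.mul_apply, hdet]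
  congr 1
  simp [Polynomial.eval_finsetSum, Q, G, mul_comm t]

/-- The change of variables formula persists up to `t = 1` since both sides are polynomial in `t`. -/
theorem setIntegral_pow_mul_det_eq {ι : Type*} [Fintype ι]
    {g : (ι → ℝ) → (ι → ℝ)} (hg : ContDiff ℝ 1 g) (hgs : HasCompactSupport g)
    {s : Set (ι → ℝ)} (hs : IsCompact s) (hsupp : Function.support g ⊆ s) (c : ℝ) (k : ℕ) :
    ∫ x in s, (1 - c * ∑ i, (x + g x) i ^ 2) ^ k * (1 + fderiv ℝ g x).det =
      ∫ x in s, (1 - c * ∑ i, x i ^ 2) ^ k := by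
  obtain ⟨p, hp⟩ := exists_polynomial_eval_eq_setIntegral_pow_mul_det hg hs c k
  obtain ⟨ε, hε, h⟩ := exists_pos_forall_setIntegral_comp_add_smul_mul_det volume hg hgs
    hs.measurableSet hsupp
  have hconst : p = Polynomial.C (∫ x in s, (1 - c * ∑ i, x i ^ 2) ^ k) := by
    refine Polynomial.eq_of_infinite_eval_eq _ _ ((Ioo_infinite hε).mono fun t ht => ?_)
    rw [mem_ofPred_eq, hp, Polynomial.eval_C]
    exact h t ht fun y => (1 - c * ∑ i, y i ^ 2) ^ k
  have h1 := hp 1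
  rw [hconst, Polynomial.eval_C] at h1
  simpa only [one_smul] using h1.symm

theorem exists_add_eq_zero_of_contDiff {ι : Type*} [Fintype ι]
    {g : (ι → ℝ) → (ι → ℝ)} (hg : ContDiff ℝ 1 g) (hgs : HasCompactSupport g) :
    ∃ x, x + g x = 0 := by
  by_contra! h
  have hgc := hg.continuous
  have hfc := hg.continuous_fderiv one_ne_zero
  obtain ⟨R, hR0, hR⟩ : ∃ R > 0, tsupport g ⊆ Metric.closedBall 0 R :=
    hgs.isBounded.subset_closedBall_lt 0 0
  set s : Set (ι → ℝ) := Metric.closedBall 0 R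
  have hs : IsCompact s := isCompact_closedBall 0 R
  have hsne : s.Nonempty := ⟨0, Metric.mem_closedBall_self hR0.le⟩
  let N : (ι → ℝ) → ℝ := fun y => ∑ i, y i ^ 2
  have hN : Continuous N := by fun_prop
  have hN0 : ∀ y, 0 ≤ N y := fun y => Finset.sum_nonneg fun i _ => sq_nonneg _
  have hNpos : ∀ y, y ≠ 0 → 0 < N y := fun y hy => by
    obtain ⟨i, hi⟩ := Function.ne_iff.1 hy
    exact (pow_pos (abs_pos.2 hi) 2).trans_le (by
      rw [sq_abs]
      exact Finset.single_le_sum (f := fun i => y i ^ 2) (fun i _ => sq_nonneg _)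
        (Finset.mem_univ i))
  have hNh : Continuous fun x => N (x + g x) := by fun_prop
  obtain ⟨x₀, hx₀, hmin⟩ := hs.exists_isMinOn hsne hNh.continuousOn
  obtain ⟨M₁, hM₁⟩ := hs.exists_bound_of_continuousOn hN.continuousOn
  obtain ⟨M₂, hM₂⟩ := hs.exists_bound_of_continuousOn hNh.continuousOn
  set δ := N (x₀ + g x₀)
  have hδ : 0 < δ := hNpos _ (h x₀)
  let M := max M₁ M₂
  have hδM : δ ≤ M := (le_abs_self _).trans ((hM₂ x₀ hx₀).trans (le_max_right _ _))
  have hM : 0 < M := hδ.trans_le hδM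
  let a := 1 - M⁻¹ * δ
  let b := 1 - M⁻¹ * (δ / 2)
  have hMδ : 0 < M⁻¹ * δ := by positivity
  have hMδ1 : M⁻¹ * δ ≤ 1 := by
    rw [inv_mul_le_iff₀ hM]; linarith
  have ha : 0 ≤ a := by simp only [a]; linarith
  have hab : a < b := by simp only [a, b]; linarith
  let C := ∫ x in s, |(1 + fderiv ℝ g x).det|
  have hdetc : Continuous fun x => (1 + fderiv ℝ g x).det :=
    ContinuousLinearMap.continuous_det.comp (by fun_prop)
  have hupper : ∀ k : ℕ, ∫ x in s, (1 - M⁻¹ * N (x + g x)) ^ k * (1 + fderiv ℝ g x).det ≤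
      a ^ k * C := fun k => by
    rw [← integral_const_mul]
    refine setIntegral_mono_on (ContinuousOn.integrableOn_compact hs (by fun_prop))
      (ContinuousOn.integrableOn_compact hs (continuous_const.mul hdetc.abs).continuousOn)
      hs.measurableSet fun x hx => ?_
    have h1 : M⁻¹ * N (x + g x) ≤ 1 := by
      rw [inv_mul_le_iff₀ hM, mul_one]
      exact (le_abs_self _).trans ((hM₂ x hx).trans (le_max_right _ _))
    have h2 : 1 - M⁻¹ * N (x + g x) ≤ a :=
      sub_le_sub_left (mul_le_mul_of_nonneg_left (hmin hx) (by positivity)) _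
    calc _ ≤ (1 - M⁻¹ * N (x + g x)) ^ k * |(1 + fderiv ℝ g x).det| :=
          mul_le_mul_of_nonneg_left (le_abs_self _) (pow_nonneg (by linarith) _)
      _ ≤ _ := mul_le_mul_of_nonneg_right (pow_le_pow_left₀ (by linarith) h2 k) (abs_nonneg _)
  let u := s ∩ {y | N y ≤ δ / 2}
  have hu : MeasurableSet u := hs.measurableSet.inter (measurableSet_le hN.measurable (by fun_prop))
  have hu0 : 0 < volume.real u := by
    rw [measureReal_def, ENNReal.toReal_pos_iff]
    constructor
    · refine Measure.measure_pos_of_mem_nhds volume (x := 0) (inter_mem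
        (Metric.closedBall_mem_nhds _ hR0) ?_)
      have : N 0 < δ / 2 := by simp [N, hδ]
      exact (hN.continuousAt.eventually (gt_mem_nhds this)).mono fun y hy => hy.le
    · exact (measure_mono inter_subset_left).trans_lt hs.measure_lt_top
  have hlower : ∀ k : ℕ, volume.real u * b ^ k ≤ ∫ x in s, (1 - M⁻¹ * N x) ^ k := fun k => by
    have hint : IntegrableOn (fun x => (1 - M⁻¹ * N x) ^ k) s :=
      ContinuousOn.integrableOn_compact hs (by fun_prop)
    calc volume.real u * b ^ k = ∫ x in u, b ^ k := by simp
      _ ≤ ∫ x in u, (1 - M⁻¹ * N x) ^ k := by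
          refine setIntegral_mono_on ?_ (hint.mono_set inter_subset_left) hu fun x hx => ?_
          · exact integrableOn_const ((measure_mono inter_subset_left).trans_lt hs.measure_lt_top).ne
          · exact pow_le_pow_left₀ (ha.trans hab.le)
              (sub_le_sub_left (mul_le_mul_of_nonneg_left hx.2 (by positivity)) _) k
      _ ≤ _ := by
          refine setIntegral_mono_set hint ?_ (inter_subset_left.eventuallyLE)
          refine (ae_restrict_mem hs.measurableSet).mono fun x hx => pow_nonneg ?_ k
          have h1 : M⁻¹ * N x ≤ 1 := by
            rw [inv_mul_le_iff₀ hM, mul_one]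
            exact (le_abs_self _).trans ((hM₁ x hx).trans (le_max_left _ _))
          linarith
  have hb : 0 < b := ha.trans_lt hab
  have hle : ∀ k : ℕ, volume.real u ≤ (a / b) ^ k * C := fun k => by
    have := (hlower k).trans ((setIntegral_pow_mul_det_eq hg hgs hs
      ((subset_tsupport g).trans hR) M⁻¹ k).symm.le.trans (hupper k))
    rw [div_pow, div_mul_eq_mul_div, le_div_iff₀ (pow_pos hb k)]
    exact this
  have hlim : Tendsto (fun k : ℕ => (a / b) ^ k * C) atTop (𝓝 (0 * C)) :=
    (tendsto_pow_atTop_nhds_zero_of_lt_one (by positivity) ((div_lt_one hb).2 hab)).mul_const C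
  have := ge_of_tendsto' hlim hle
  linarith

/-- A compactly supported continuous perturbation of the identity of `ι → ℝ` has a zero. -/
theorem exists_add_eq_zero_of_hasCompactSupport {ι : Type*} [Fintype ι]
    {g : (ι → ℝ) → (ι → ℝ)} (hg : Continuous g) (hgs : HasCompactSupport g) :
    ∃ x, x + g x = 0 := by
  by_contra! h
  obtain ⟨g', hg', happ, hsupp⟩ := hg.exists_contDiff_approx 1 (ε := fun x => ‖x + g x‖)
    (by fun_prop) fun x => norm_pos_iff.2 (h x)
  obtain ⟨x, hx⟩ := exists_add_eq_zero_of_contDiff hg' (hgs.mono hsupp)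
  have := happ x
  rw [dist_comm, dist_eq_norm, ← add_sub_add_left_eq_sub _ _ x, hx, sub_zero] at this
  exact this.false

/-- A form of **Brouwer's fixed point theorem**. -/
theorem exists_eq_self_of_continuous_of_norm_le_one {ι : Type*} [Fintype ι]
    {f : (ι → ℝ) → (ι → ℝ)} (hf : Continuous f) (hf1 : ∀ x, ‖f x‖ ≤ 1) :
    ∃ x, f x = x := by
  let χ : ContDiffBump (0 : ι → ℝ) := ⟨1, 2, one_pos, one_lt_two⟩
  obtain ⟨x, hx⟩ := exists_add_eq_zero_of_hasCompactSupport (g := fun x => χ x • -f x)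
    (χ.continuous.smul hf.neg) χ.hasCompactSupport.smul_right
  rw [smul_neg, ← sub_eq_add_neg, sub_eq_zero] at hx
  have hx1 : ‖x‖ ≤ 1 := by
    rw [hx, norm_smul, Real.norm_of_nonneg χ.nonneg]
    exact mul_le_one₀ χ.le_one (norm_nonneg _) (hf1 x)
  have hχ : χ x = 1 := χ.one_of_mem_closedBall (by simpa [χ] using hx1)
  rw [hχ, one_smul] at hx
  exact ⟨x, hx.symm⟩

/-- If every point of a convex combination with positive weight is strictly better than `r` for a
quasiconcave function, then so is the combination. -/
theorem QuasiconcaveOn.lt_map_sum {κ V : Type*} [Fintype κ] [AddCommGroup V] [Module ℝ V]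
    {S : Set V} {F : V → ℝ} (hF : QuasiconcaveOn ℝ S F) {t : κ → ℝ} (ht : ∀ c, 0 ≤ t c)
    (ht1 : ∑ c, t c = 1) {a : κ → V} (ha : ∀ c, a c ∈ S) {r : ℝ}
    (hr : ∀ c, 0 < t c → r < F (a c)) : r < F (∑ c, t c • a c) := by
  classical
  let u := Finset.univ.filter fun c => 0 < t c
  have hmem : ∀ c, c ∉ u → t c = 0 := fun c hc =>
    le_antisymm (by simpa [u] using hc) (ht c)
  have hu1 : ∑ c ∈ u, t c = 1 := by
    rw [← ht1]
    exact Finset.sum_subset (Finset.subset_univ _) fun c _ hc => hmem c hc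
  have hune : u.Nonempty := by
    by_contra h
    rw [Finset.not_nonempty_iff_eq_empty] at h
    simp [h] at hu1
  obtain ⟨c₀, hc₀, hmin⟩ := u.exists_min_image (fun c => F (a c)) hune
  have hsum : ∑ c, t c • a c = ∑ c ∈ u, t c • a c :=
    (Finset.sum_subset (Finset.subset_univ _) fun c _ hc => by simp [hmem c hc]).symm
  have := (hF (F (a c₀))).sum_mem (t := u) (w := t) (z := a) (fun c _ => ht c) hu1
    fun c hc => ⟨ha c, hmin c hc⟩
  rw [hsum]
  exact (hr c₀ (Finset.mem_filter.1 hc₀).2).trans_le this.2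

/-- A profile against which no player gains by deviating to one of finitely many strategies. -/
theorem exists_forall_le_of_finite {I κ V : Type*} [Fintype I] [Fintype κ] [Nonempty κ]
    [AddCommGroup V] [Module ℝ V] [TopologicalSpace V] [ContinuousAdd V] [ContinuousSMul ℝ V]
    {S : I → Set V} (hS : ∀ i, Convex ℝ (S i)) {G : I → V → (I → V) → ℝ}
    (hG : ∀ i, ContinuousOn (fun p : V × (I → V) => G i p.1 p.2) (S i ×ˢ univ))
    (hq : ∀ i z, QuasiconcaveOn ℝ (S i) fun b => G i b z)
    {a : κ → I → V} (ha : ∀ c i, a c i ∈ S i) :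
    ∃ x : I → V, (∀ i, x i ∈ S i) ∧ ∀ i c, G i (a c i) x ≤ G i (x i) x := by
  let q : (I × κ → ℝ) → I → κ → ℝ := fun t i c => max (t (i, c)) 0 + max 0 (1 - ∑ d, t (i, d))
  let Q : (I × κ → ℝ) → I → ℝ := fun t i => ∑ c, q t i c
  let x : (I × κ → ℝ) → I → V := fun t i => ∑ c, (q t i c / Q t i) • a c i
  let w : (I × κ → ℝ) → I → κ → ℝ := fun t i c =>
    max 0 (G i (a c i) (x t) - G i (x t i) (x t))
  have hq0 : ∀ t i c, 0 ≤ q t i c := fun t i c =>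
    add_nonneg (le_max_right _ _) (le_max_left _ _)
  have hQ : ∀ t i, 0 < Q t i := fun t i => by
    refine (Finset.sum_nonneg fun c _ => hq0 t i c).lt_of_ne fun h => ?_
    have h0 := (Finset.sum_eq_zero_iff_of_nonneg fun c _ => hq0 t i c).1 h.symm
    have h1 : ∑ d, t (i, d) ≤ 0 := Finset.sum_nonpos fun c hc => by
      have := h0 c hc
      simp only [q] at this
      linarith [le_max_left (t (i, c)) 0, le_max_left 0 (1 - ∑ d, t (i, d))]
    obtain ⟨c⟩ := ‹Nonempty κ›
    have := h0 c (Finset.mem_univ c)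
    simp only [q] at this
    linarith [le_max_right (t (i, c)) 0, le_max_right 0 (1 - ∑ d, t (i, d))]
  have hqc : ∀ i c, Continuous fun t => q t i c := fun i c => by fun_prop
  have hQc : ∀ i, Continuous fun t => Q t i := fun i => continuous_finsetSum _ fun c _ => hqc i c
  have hxc : Continuous x := continuous_pi fun i => continuous_finsetSum _ fun c _ =>
    ((hqc i c).div (hQc i) fun t => (hQ t i).ne').smul continuous_const
  have hxS : ∀ t i, x t i ∈ S i := fun t i =>
    (hS i).sum_mem (fun c _ => div_nonneg (hq0 t i c) (hQ t i).le)
      (by rw [← Finset.sum_div]; exact div_self (hQ t i).ne') fun c _ => ha c i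
  have hwc : ∀ i c, Continuous fun t => w t i c := fun i c =>
    continuous_const.max (((hG i).comp_continuous (continuous_const.prodMk hxc)
      fun t => ⟨ha c i, mem_univ _⟩).sub ((hG i).comp_continuous
      (((continuous_apply i).comp hxc).prodMk hxc) fun t => ⟨hxS t i, mem_univ _⟩))
  have hw0 : ∀ t i c, 0 ≤ w t i c := fun t i c => le_max_left _ _
  have hW0 : ∀ t i, 0 ≤ ∑ c, w t i c := fun t i => Finset.sum_nonneg fun c _ => hw0 t i c
  let f : (I × κ → ℝ) → (I × κ → ℝ) := fun t p =>
    (q t p.1 p.2 + w t p.1 p.2) / (Q t p.1 + ∑ c, w t p.1 c)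
  have hD : ∀ t i, 0 < Q t i + ∑ c, w t i c := fun t i =>
    add_pos_of_pos_of_nonneg (hQ t i) (hW0 t i)
  have hf0 : ∀ t p, 0 ≤ f t p := fun t p =>
    div_nonneg (add_nonneg (hq0 _ _ _) (hw0 _ _ _)) (hD _ _).le
  have hf1 : ∀ t i, ∑ c, f t (i, c) = 1 := fun t i => by
    simp only [f]
    rw [← Finset.sum_div, Finset.sum_add_distrib]
    exact div_self (hD t i).ne'
  have hfc : Continuous f := continuous_pi fun p => ((hqc _ _).add (hwc _ _)).div
    ((hQc _).add (continuous_finsetSum _ fun c _ => hwc _ c)) fun t => (hD _ _).ne'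
  obtain ⟨t, ht⟩ := exists_eq_self_of_continuous_of_norm_le_one hfc fun t =>
    (pi_norm_le_iff_of_nonneg zero_le_one).2 fun p => by
      rw [Real.norm_of_nonneg (hf0 t p), ← hf1 t p.1]
      exact Finset.single_le_sum (f := fun c => f t (p.1, c)) (fun c _ => hf0 t _)
        (Finset.mem_univ p.2)
  have ht0 : ∀ p, 0 ≤ t p := fun p => by rw [← ht]; exact hf0 t p
  have ht1 : ∀ i, ∑ c, t (i, c) = 1 := fun i => by rw [← hf1 t i, ht]
  have hqt : ∀ i c, q t i c = t (i, c) := fun i c => by simp [q, ht1, ht0]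
  have hQt : ∀ i, Q t i = 1 := fun i => by simp only [Q, hqt, ht1]
  have hxt : ∀ i, x t i = ∑ c, t (i, c) • a c i := fun i => by simp only [x, hqt, hQt, div_one]
  refine ⟨x t, hxS t, fun i c => ?_⟩
  have hfix : ∀ c, t (i, c) * ∑ d, w t i d = w t i c := fun c => by
    have h := congrFun ht (i, c)
    simp only [f, hqt, hQt] at h
    rw [div_eq_iff (by linarith [hW0 t i])] at h
    linarith
  have hW : ∑ d, w t i d = 0 := by
    by_contra hne
    have hpos := (hW0 t i).lt_of_ne' hne
    refine (QuasiconcaveOn.lt_map_sum (hq i (x t)) (fun c => ht0 (i, c)) (ht1 i)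
      (fun c => ha c i) (r := G i (x t i) (x t)) fun c hc => ?_).ne (by rw [hxt])
    have : 0 < w t i c := hfix c ▸ mul_pos hc hpos
    simpa [w] using this
  have hwt : w t i c = 0 := by rw [← hfix c, hW, mul_zero]
  simpa [w] using hwt

/-- **Nash equilibria** exist in games with compact convex strategy sets and continuous payoffs
that are quasiconcave in the own strategy. -/
theorem exists_nash_equilibrium {I V : Type*} [Fintype I]
    [AddCommGroup V] [Module ℝ V] [TopologicalSpace V] [ContinuousAdd V] [ContinuousSMul ℝ V]
    {S : I → Set V} (hSne : ∀ i, (S i).Nonempty) (hS : ∀ i, Convex ℝ (S i))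
    (hSc : ∀ i, IsCompact (S i)) {G : I → V → (I → V) → ℝ}
    (hG : ∀ i, ContinuousOn (fun p : V × (I → V) => G i p.1 p.2) (S i ×ˢ univ))
    (hq : ∀ i z, QuasiconcaveOn ℝ (S i) fun b => G i b z) :
    ∃ x : I → V, (∀ i, x i ∈ S i) ∧ ∀ i, ∀ b ∈ S i, G i b x ≤ G i (x i) x := by
  classical
  have := fun i => isCompact_iff_compactSpace.1 (hSc i)
  have := fun i => (hSne i).to_subtype
  let C : (∀ i, S i) → Set (∀ i, S i) := fun y =>
    {x | ∀ i, G i (y i) (fun j => x j) ≤ G i (x i) fun j => x j}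
  have hcoe : Continuous fun (x : ∀ i, S i) (j : I) => (x j : V) := by fun_prop
  obtain ⟨x, hx⟩ : (⋂ y, C y).Nonempty := by
    refine CompactSpace.iInter_nonempty (fun y => ?_) fun u => ?_
    · simp only [C, ofPred_forall]
      refine isClosed_iInter fun i => isClosed_le ?_ ?_
      · exact (hG i).comp_continuous (continuous_const.prodMk hcoe)
          fun x => ⟨(y i).2, mem_univ _⟩
      · exact (hG i).comp_continuous (((continuous_apply i).comp hcoe).prodMk hcoe)
          fun x => ⟨(x i).2, mem_univ _⟩
    · obtain ⟨x, hxS, hx⟩ := exists_forall_le_of_finite (κ := Option u) hS hG hq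
        (a := fun c i => (c.elim (Classical.arbitrary (∀ i, S i)) Subtype.val) i)
        fun c i => Subtype.prop _
      exact ⟨fun i => ⟨x i, hxS i⟩, mem_iInter₂.2 fun y hy i => hx i (some ⟨y, hy⟩)⟩
  refine ⟨fun i => x i, fun i => (x i).2, fun i b hb => ?_⟩
  have := mem_iInter.1 hx (Function.update (fun j => x j) i ⟨b, hb⟩) i
  simpa using this

/-- **Existence of Nash equilibria in network games** (Corollary 1 of the paper).
In a network game with nonempty, convex, weakly compact strategy sets in a separable
Banach space, and utility functions that are weakly continuous and quasi-concave in
own strategy, a Nash equilibrium exists. -/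
theorem network_game_existence
    {E : Type*} [NormedAddCommGroup E] [NormedSpace ℝ E] [CompleteSpace E]
    [TopologicalSpace.SeparableSpace E]
    -- the finite player set `I = {1, …, n}`
    (n : ℕ) (hn : 0 < n)
    -- the adjacency matrix
    (A : Fin n → Fin n → ℝ) (hA : ∀ i j, A i j ∈ Set.Icc (0 : ℝ) 1)
    -- the strategy sets: nonempty, convex and weakly compact
    (S : Fin n → Set E)
    (hSne : ∀ i, (S i).Nonempty)
    (hSconv : ∀ i, Convex ℝ (S i))
    (hScomp : ∀ i, IsCompact (toWeakSpace ℝ E '' S i))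
    -- the utility functions
    (v : Fin n → E → E → ℝ)
    -- each `v i` is continuous on `S i × E` when both carry the weak topology
    (hvcont : ∀ i, ContinuousOn
      (fun p : WeakSpace ℝ E × WeakSpace ℝ E =>
        v i ((toWeakSpace ℝ E).symm p.1) ((toWeakSpace ℝ E).symm p.2))
      ((toWeakSpace ℝ E '' S i) ×ˢ (Set.univ : Set (WeakSpace ℝ E))))
    -- each `v i (·, e)` is quasi-concave on `S i`
    (hvquasi : ∀ i e, QuasiconcaveOn ℝ (S i) (fun a => v i a e)) :
    ∃ s : Fin n → E, (∀ i, s i ∈ S i) ∧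
      ∀ i, ∀ a ∈ S i,
        v i a ((n : ℝ)⁻¹ • ∑ j, A i j • s j) ≤
          v i (s i) ((n : ℝ)⁻¹ • ∑ j, A i j • s j) := by
  let L := toWeakSpace ℝ E
  have hquasi : ∀ i (z : Fin n → WeakSpace ℝ E), QuasiconcaveOn ℝ (L '' S i)
      fun b => v i (L.symm b) (L.symm ((n : ℝ)⁻¹ • ∑ j, A i j • z j)) := fun i z r => by
    refine (congrArg (Convex ℝ) (Set.ext fun b => ⟨?_, ?_⟩)).mpr
      ((hvquasi i (L.symm ((n : ℝ)⁻¹ • ∑ j, A i j • z j)) r).linear_image L.toLinearMap)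
    · rintro ⟨⟨b, hb, rfl⟩, hr⟩
      exact ⟨b, ⟨hb, by simpa using hr⟩, rfl⟩
    · rintro ⟨b, ⟨hb, hr⟩, rfl⟩
      exact ⟨⟨b, hb, rfl⟩, by simpa using hr⟩
  obtain ⟨x, hxS, hx⟩ := exists_nash_equilibrium (S := fun i => L '' S i)
    (G := fun i b z => v i (L.symm b) (L.symm ((n : ℝ)⁻¹ • ∑ j, A i j • z j)))
    (fun i => (hSne i).image _) (fun i => (hSconv i).linear_image L.toLinearMap) hScomp
    (fun i => (hvcont i).comp (f := fun p : WeakSpace ℝ E × (Fin n → WeakSpace ℝ E) =>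
      (p.1, (n : ℝ)⁻¹ • ∑ j, A i j • p.2 j)) (by fun_prop) fun p hp => ⟨hp.1, mem_univ _⟩) hquasi
  refine ⟨fun i => L.symm (x i), fun i => ?_, fun i a ha => ?_⟩
  · obtain ⟨b, hb, hbx⟩ := hxS i
    simpa [← hbx] using hb
  · simpa [map_sum] using hx i (L a) ⟨a, ha, rfl⟩
end
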